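/- arXiv:1510.08230 — 2 statements merged into one kernel-verified Lean document; each statement's English description precedes it below -/
import Mathlib

section
/- Kantorovich dual equality for the entropic cost: under the hypotheses (Exi), (Reg1) and (Reg2), the entropic cost satisfies A(μ0,μ1) = H(μ0|m) + sup{ ∫ ψ dμ1 − ∫ Q^R ψ dμ0 : ψ ∈ C_b(ℝⁿ) }, where for bounded continuous ψ one sets Q^R ψ(x) := log T_1(e^ψ)(x) = log ∫ e^{ψ(y)} p(x,y) m(dy). -/
open MeasureTheory Real Filter Set
open scoped ENNReal RealInnerProductSpace Topology

noncomputable section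

open Classical in
/-- Relative entropy `H(q|r)` of a probability measure `q` with respect to a σ-finite
measure `r`, with value `⊤` when it is not (finitely) defined. -/
def relEnt {α : Type*} [MeasurableSpace α] (q r : Measure α) : EReal :=
  if q ≪ r ∧ Integrable (fun x => Real.log ((q.rnDeriv r x).toReal)) q then
    (((∫ x, Real.log ((q.rnDeriv r x).toReal) ∂q) : ℝ) : EReal)
  else ⊤

/-- Entropic cost associated with a reference measure `r` on the product space:
infimum of `H(π|r)` over couplings `π` of `μ` and `ν`. -/
def entCost {α : Type*} [MeasurableSpace α] (r : Measure (α × α)) (μ ν : Measure α) : EReal :=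
  sInf { e : EReal | ∃ pl : Measure (α × α), IsProbabilityMeasure pl ∧
    pl.map Prod.fst = μ ∧ pl.map Prod.snd = ν ∧ e = relEnt pl r }

/-- Laplacian of `f : ℝⁿ → ℝ` as the sum of second directional derivatives along the
standard basis. -/
def lap (n : ℕ) (f : EuclideanSpace ℝ (Fin n) → ℝ) (x : EuclideanSpace ℝ (Fin n)) : ℝ :=
  ∑ i : Fin n, iteratedDeriv 2 (fun s : ℝ => f (x + s • EuclideanSpace.single i (1 : ℝ))) 0

/-- Existence hypothesis (Exi). -/
def Exi (n : ℕ) (V : EuclideanSpace ℝ (Fin n) → ℝ) : Prop :=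
  (Tendsto V (cocompact (EuclideanSpace ℝ (Fin n))) atTop ∧
      BddBelow (Set.range fun x => ‖gradient V x‖ ^ 2 - lap n V x / 2)) ∨
    ∃ c : ℝ, 0 < c ∧ ∀ x : EuclideanSpace ℝ (Fin n), -⟪x, gradient V x⟫ ≤ c * (1 + ‖x‖ ^ 2)

/-- The measure `m = e^{-V}·Leb`. -/
def mV (n : ℕ) (V : EuclideanSpace ℝ (Fin n) → ℝ) : Measure (EuclideanSpace ℝ (Fin n)) :=
  volume.withDensity fun x => ENNReal.ofReal (Real.exp (-V x))

/-- The semigroup associated with a kernel family `p` and reference measure `m`: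
`T_t f (x) = ∫ f(y) p_t(x,y) m(dy)` for `t ≠ 0`, `T_0 f = f`. -/
def Tsg (n : ℕ) (m : Measure (EuclideanSpace ℝ (Fin n)))
    (p : ℝ → EuclideanSpace ℝ (Fin n) → EuclideanSpace ℝ (Fin n) → ℝ) (t : ℝ)
    (f : EuclideanSpace ℝ (Fin n) → ℝ) (x : EuclideanSpace ℝ (Fin n)) : ℝ :=
  if t = 0 then f x else ∫ y, f y * p t x y ∂m

/-- Hypothesis (Reg1) together with the defining properties of the Kolmogorov
Markov semigroup with generator `½(Δ - ∇V·∇)`: `p` is a symmetric probability density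
kernel with respect to `m`, satisfying the Chapman-Kolmogorov equation, and the
associated semigroup solves the backward Kolmogorov equation. -/
structure IsKolmogorov (n : ℕ) (V : EuclideanSpace ℝ (Fin n) → ℝ)
    (m : Measure (EuclideanSpace ℝ (Fin n)))
    (p : ℝ → EuclideanSpace ℝ (Fin n) → EuclideanSpace ℝ (Fin n) → ℝ) : Prop where
  meas : ∀ t, Measurable (Function.uncurry (p t))
  nonneg : ∀ t x y, 0 ≤ p t x y
  symm : ∀ t x y, p t x y = p t y x
  mass : ∀ t, 0 < t → ∀ x, ∫ y, p t x y ∂m = 1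
  chapman : ∀ s t, 0 < s → 0 < t → ∀ x y, ∫ z, p s x z * p t z y ∂m = p (s + t) x y
  generator : ∀ f : EuclideanSpace ℝ (Fin n) → ℝ, ContDiff ℝ (⊤ : ℕ∞) f →
    HasCompactSupport f → ∀ t, 0 < t → ∀ x,
      HasDerivAt (fun s => Tsg n m p s f x)
        (2⁻¹ * (lap n (Tsg n m p t f) x - ⟪gradient V x, gradient (Tsg n m p t f) x⟫)) t

/-- Regularity hypothesis (Reg2) for the kernel `p` and the marginals `μ0, μ1`. -/
def Reg2 (n : ℕ) (m : Measure (EuclideanSpace ℝ (Fin n)))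
    (p : EuclideanSpace ℝ (Fin n) → EuclideanSpace ℝ (Fin n) → ℝ)
    (μ0 μ1 : Measure (EuclideanSpace ℝ (Fin n))) : Prop :=
  (∃ A B : EuclideanSpace ℝ (Fin n) → ℝ, Measurable A ∧ Measurable B ∧
      (∀ x, 0 ≤ A x) ∧ (∀ x, 0 ≤ B x) ∧
      (∀ x y, Real.exp (-A x - A y) ≤ p x y) ∧
      Integrable (fun z : EuclideanSpace ℝ (Fin n) × EuclideanSpace ℝ (Fin n) =>
        Real.exp (-B z.1 - B z.2) * p z.1 z.2) (m.prod m) ∧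
      Integrable (fun x => A x + B x) μ0 ∧ Integrable (fun x => A x + B x) μ1) ∧
    relEnt μ0 m ≠ ⊤ ∧ relEnt μ1 m ≠ ⊤

/-- The joint law `R₀₁(dx dy) = m(dx) p(x,y) m(dy)` of the initial and final positions. -/
def R01 (n : ℕ) (m : Measure (EuclideanSpace ℝ (Fin n)))
    (p : EuclideanSpace ℝ (Fin n) → EuclideanSpace ℝ (Fin n) → ℝ) :
    Measure (EuclideanSpace ℝ (Fin n) × EuclideanSpace ℝ (Fin n)) :=
  (m.prod m).withDensity fun z => ENNReal.ofReal (p z.1 z.2)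

open ProbabilityTheory BoundedContinuousFunction

/-- A sequence of square-integrable functions that is Cauchy in `L²` has a limit `g`, almost
everywhere along a subsequence, and its squares converge to `g ^ 2` against bounded functions. -/
lemma exists_limit_of_cauchy_sq {Ω : Type*} [MeasurableSpace Ω] {P : Measure Ω}
    {u : ℕ → Ω → ℝ} (hu : ∀ k, MemLp (u k) 2 P) {a : ℕ → ℝ} (ha : Tendsto a atTop (𝓝 0))
    (hua : ∀ k l, ∫ z, (u k z - u l z) ^ 2 ∂P ≤ a k + a l) :
    ∃ g : Ω → ℝ, Measurable g ∧ Integrable (fun z => g z ^ 2) P ∧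
      (∃ ns : ℕ → ℕ, StrictMono ns ∧
        ∀ᵐ z ∂P, Tendsto (fun k => u (ns k) z) atTop (𝓝 (g z))) ∧
      ∀ (h : Ω → ℝ) (C : ℝ), Measurable h → (∀ z, |h z| ≤ C) →
        Tendsto (fun k => ∫ z, h z * u k z ^ 2 ∂P) atTop (𝓝 (∫ z, h z * g z ^ 2 ∂P)) := by
  have hd : ∀ k l, dist ((hu k).toLp (u k)) ((hu l).toLp (u l)) ^ 2 ≤ a k + a l := by
    intro k l
    rw [dist_eq_norm, ← MemLp.toLp_sub, ← real_inner_self_eq_norm_sq, L2.inner_def]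
    refine le_trans (le_of_eq (integral_congr_ae ?_)) (hua k l)
    filter_upwards [MemLp.coeFn_toLp ((hu k).sub (hu l))] with z hz
    rw [hz]
    simp [sq]
  have hcau : CauchySeq fun k => (hu k).toLp (u k) := by
    refine Metric.cauchySeq_iff.2 fun ε hε => ?_
    obtain ⟨N, hN⟩ := eventually_atTop.1
      (ha.eventually (gt_mem_nhds (show 0 < ε ^ 2 / 2 by positivity)))
    refine ⟨N, fun k hk l hl => lt_of_pow_lt_pow_left₀ 2 hε.le ((hd k l).trans_lt ?_)⟩
    linarith [hN k hk, hN l hl]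
  obtain ⟨G, hG⟩ := cauchySeq_tendsto_of_complete hcau
  obtain ⟨g, hgm, hgG⟩ := (Lp.stronglyMeasurable G).measurable.aemeasurable (μ := P)
  have hg2 : MemLp g 2 P := (memLp_congr_ae hgG).1 (Lp.memLp G)
  refine ⟨g, hgm, hg2.integrable_sq, ?_, ?_⟩
  · obtain ⟨ns, hns, hae⟩ := (tendstoInMeasure_of_tendsto_Lp hG).exists_seq_tendsto_ae
    refine ⟨ns, hns, ?_⟩
    filter_upwards [hae, hgG, ae_all_iff.2 fun k => MemLp.coeFn_toLp (hu k)] with z h1 h2 h3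
    simpa only [h3, h2] using h1
  · intro h C hm hC
    have hb : ∀ {v : Ω → ℝ}, MemLp v 2 P → MemLp (fun z => h z * v z) 2 P := fun hv =>
      MemLp.of_le_mul (c := C) hv (hm.aestronglyMeasurable.mul hv.1) (ae_of_all _ fun z => by
        rw [norm_mul]; exact mul_le_mul_of_nonneg_right (hC z) (norm_nonneg _))
    have h1 : Tendsto (fun k => (hb (hu k)).toLp _) atTop (𝓝 ((hb hg2).toLp _)) := by
      refine tendsto_iff_norm_sub_tendsto_zero.2 (squeeze_zero (fun _ => norm_nonneg _)
        (fun k => ?_) (by simpa using (tendsto_iff_norm_sub_tendsto_zero.1 hG).const_mul C))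
      refine Lp.norm_le_mul_norm_of_ae_le_mul ?_
      filter_upwards [Lp.coeFn_sub ((hb (hu k)).toLp _) ((hb hg2).toLp _),
        Lp.coeFn_sub ((hu k).toLp _) G, (hu k).coeFn_toLp, (hb (hu k)).coeFn_toLp,
        (hb hg2).coeFn_toLp, hgG] with z e1 e2 e3 e4 e5 e6
      rw [e1, e2, Pi.sub_apply, Pi.sub_apply, e3, e4, e5, e6, ← mul_sub, norm_mul]
      exact mul_le_mul_of_nonneg_right (hC z) (norm_nonneg _)
    have h2 := h1.inner (𝕜 := ℝ) hG
    simp only [L2.inner_def] at h2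
    convert h2 using 2
    · refine integral_congr_ae ?_
      rename_i k
      filter_upwards [(hu k).coeFn_toLp, (hb (hu k)).coeFn_toLp] with z e1 e2
      rw [e1, e2]
      simp only [RCLike.inner_apply, conj_trivial]
      ring
    · refine integral_congr_ae ?_
      filter_upwards [(hb hg2).coeFn_toLp, hgG] with z e1 e2
      rw [e1, e2]
      simp only [RCLike.inner_apply, conj_trivial]
      ring

lemma nonpos_of_forall_mul_le_sq_mul {a b t₀ : ℝ} (ht₀ : 0 < t₀)
    (h : ∀ t, 0 < t → t ≤ t₀ → t * a ≤ t ^ 2 * b) : a ≤ 0 := by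
  have hlim : Tendsto (fun t : ℝ => t * b) (𝓝[>] 0) (𝓝 0) := by
    have : Tendsto (fun t : ℝ => t * b) (𝓝 0) (𝓝 (0 * b)) := tendsto_id.mul_const b
    rw [zero_mul] at this
    exact this.mono_left nhdsWithin_le_nhds
  refine ge_of_tendsto hlim ?_
  filter_upwards [Ioc_mem_nhdsGT ht₀] with t ht
  have := h t ht.1 ht.2
  rw [sq, mul_assoc] at this
  exact le_of_mul_le_mul_left this ht.1

lemma norm_smul_le_one_of_le {E : Type*} [NormedAddCommGroup E] [NormedSpace ℝ E]
    {t : ℝ} (ht : 0 < t) (h : E) (hle : t ≤ (‖h‖ + 1)⁻¹) :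
    ‖t • h‖ ≤ 1 := by
  rw [norm_smul, Real.norm_eq_abs, abs_of_pos ht]
  have h0 := norm_nonneg h
  calc t * ‖h‖ ≤ (‖h‖ + 1)⁻¹ * (‖h‖ + 1) := by gcongr; linarith
    _ = 1 := inv_mul_cancel₀ (by positivity)

section SemiDual

variable {X Y : Type*} [MeasurableSpace X] [MeasurableSpace Y] [TopologicalSpace Y]

/-- The log-partition function `x ↦ log ∫ e^ψ dκ_x`. -/
def logPartition (κ : Kernel X Y) (ψ : Y →ᵇ ℝ) (x : X) : ℝ :=
  Real.log (∫ y, Real.exp (ψ y) ∂κ x)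

/-- The semi-dual functional `ψ ↦ ∫ ψ dν - ∫ log (∫ e^ψ dκ_x) μ(dx)`. -/
def semiDual (μ : Measure X) (κ : Kernel X Y) (ν : Measure Y) (ψ : Y →ᵇ ℝ) : ℝ :=
  (∫ y, ψ y ∂ν) - ∫ x, logPartition κ ψ x ∂μ

/-- The density with respect to `μ ⊗ₘ κ` of the Gibbs tilt of `κ` by `ψ`. -/
def gibbsDensity (κ : Kernel X Y) (ψ : Y →ᵇ ℝ) (z : X × Y) : ℝ :=
  Real.exp (ψ z.2 - logPartition κ ψ z.1)

lemma gibbsDensity_pos (κ : Kernel X Y) (ψ : Y →ᵇ ℝ) (z : X × Y) :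
    0 < gibbsDensity κ ψ z := Real.exp_pos _

lemma gibbsDensity_mk (κ : Kernel X Y) (ψ : Y →ᵇ ℝ) (x : X) (y : Y) :
    gibbsDensity κ ψ (x, y) = Real.exp (ψ y) * Real.exp (-logPartition κ ψ x) := by
  rw [gibbsDensity, sub_eq_add_neg, Real.exp_add]

lemma logPartition_zero (κ : Kernel X Y) [IsMarkovKernel κ] (x : X) :
    logPartition κ (0 : Y →ᵇ ℝ) x = 0 := by
  simp [logPartition]

lemma semiDual_zero (μ : Measure X) (κ : Kernel X Y) [IsMarkovKernel κ] (ν : Measure Y) :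
    semiDual μ κ ν 0 = 0 := by
  simp [semiDual, logPartition_zero]

variable [BorelSpace Y]

lemma measurable_bcf (ψ : Y →ᵇ ℝ) : Measurable ψ := ψ.continuous.measurable

lemma integrable_exp_bcf (ρ : Measure Y) [IsFiniteMeasure ρ] (ψ : Y →ᵇ ℝ) :
    Integrable (fun y => Real.exp (ψ y)) ρ := by
  refine Integrable.of_bound (measurable_bcf ψ).exp.aestronglyMeasurable (Real.exp ‖ψ‖)
    (ae_of_all _ fun y => ?_)
  rw [Real.norm_eq_abs, Real.abs_exp]
  exact Real.exp_le_exp.2 ((le_abs_self _).trans (ψ.norm_coe_le_norm y))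

lemma measurable_logPartition (κ : Kernel X Y) (ψ : Y →ᵇ ℝ) :
    Measurable (logPartition κ ψ) :=
  (StronglyMeasurable.integral_kernel
    (measurable_bcf ψ).exp.stronglyMeasurable).measurable.log

lemma measurable_gibbsDensity (κ : Kernel X Y) (ψ : Y →ᵇ ℝ) :
    Measurable (gibbsDensity κ ψ) :=
  (((measurable_bcf ψ).comp measurable_snd).sub
    ((measurable_logPartition κ ψ).comp measurable_fst)).exp

variable (κ : Kernel X Y) [IsMarkovKernel κ]

lemma integral_exp_bcf_pos (ψ : Y →ᵇ ℝ) (x : X) : 0 < ∫ y, Real.exp (ψ y) ∂κ x :=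
  integral_exp_pos (integrable_exp_bcf _ ψ)

lemma exp_logPartition (ψ : Y →ᵇ ℝ) (x : X) :
    Real.exp (logPartition κ ψ x) = ∫ y, Real.exp (ψ y) ∂κ x :=
  Real.exp_log (integral_exp_bcf_pos κ ψ x)

lemma logPartition_le_add_norm_sub (ψ φ : Y →ᵇ ℝ) (x : X) :
    logPartition κ ψ x ≤ logPartition κ φ x + ‖ψ - φ‖ := by
  rw [← Real.exp_le_exp, Real.exp_add, exp_logPartition, exp_logPartition, ← integral_mul_const]
  refine integral_mono (integrable_exp_bcf _ _) ((integrable_exp_bcf _ _).mul_const _) fun y => ?_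
  simp only [← Real.exp_add]
  refine Real.exp_le_exp.2 ?_
  have := (le_abs_self _).trans ((ψ - φ).norm_coe_le_norm y)
  simp only [BoundedContinuousFunction.sub_apply] at this
  linarith

lemma abs_logPartition_le (ψ : Y →ᵇ ℝ) (x : X) : |logPartition κ ψ x| ≤ ‖ψ‖ := by
  have h1 := logPartition_le_add_norm_sub κ ψ 0 x
  have h2 := logPartition_le_add_norm_sub κ 0 ψ x
  rw [logPartition_zero] at h1 h2
  rw [sub_zero] at h1
  rw [zero_sub, norm_neg] at h2
  exact abs_le.2 ⟨by linarith, by linarith⟩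

lemma integrable_logPartition (μ : Measure X) [IsFiniteMeasure μ] (ψ : Y →ᵇ ℝ) :
    Integrable (logPartition κ ψ) μ :=
  Integrable.of_bound (measurable_logPartition κ ψ).aestronglyMeasurable ‖ψ‖
    (ae_of_all _ fun x => abs_logPartition_le κ ψ x)

lemma gibbsDensity_le (ψ : Y →ᵇ ℝ) (z : X × Y) :
    gibbsDensity κ ψ z ≤ Real.exp (‖ψ‖ + ‖ψ‖) := by
  refine Real.exp_le_exp.2 ?_
  have h1 := (le_abs_self _).trans (ψ.norm_coe_le_norm z.2)
  have h2 := (abs_le.1 (abs_logPartition_le κ ψ z.1)).1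
  linarith

lemma integrable_mul_gibbsDensity (ρ : Measure (X × Y)) [IsFiniteMeasure ρ] (ψ : Y →ᵇ ℝ)
    {h : X × Y → ℝ} (hm : Measurable h) {C : ℝ} (hC : ∀ z, |h z| ≤ C) :
    Integrable (fun z => h z * gibbsDensity κ ψ z) ρ := by
  refine Integrable.of_bound (hm.mul (measurable_gibbsDensity κ ψ)).aestronglyMeasurable
    (C * Real.exp (‖ψ‖ + ‖ψ‖)) (ae_of_all _ fun z => ?_)
  rw [Real.norm_eq_abs, abs_mul, abs_of_pos (gibbsDensity_pos κ ψ z)]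
  exact mul_le_mul (hC z) (gibbsDensity_le κ ψ z) (gibbsDensity_pos κ ψ z).le
    ((abs_nonneg _).trans (hC z))

lemma integral_gibbsDensity_kernel (ψ : Y →ᵇ ℝ) (x : X) :
    ∫ y, gibbsDensity κ ψ (x, y) ∂κ x = 1 := by
  simp_rw [gibbsDensity_mk]
  rw [integral_mul_const, ← exp_logPartition, ← Real.exp_add, add_neg_cancel, Real.exp_zero]

variable (μ : Measure X) [IsProbabilityMeasure μ] (ν : Measure Y) [IsProbabilityMeasure ν]

lemma integral_comp_fst_mul_gibbsDensity (ψ : Y →ᵇ ℝ) {h : X → ℝ} (hm : Measurable h) {C : ℝ}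
    (hC : ∀ x, |h x| ≤ C) :
    ∫ z, h z.1 * gibbsDensity κ ψ z ∂(μ ⊗ₘ κ) = ∫ x, h x ∂μ := by
  have hint : Integrable (fun z : X × Y => h z.1 * gibbsDensity κ ψ z) (μ ⊗ₘ κ) :=
    integrable_mul_gibbsDensity κ _ ψ (hm.comp measurable_fst) fun z => hC z.1
  rw [Measure.integral_compProd hint]
  simp_rw [integral_const_mul, integral_gibbsDensity_kernel, mul_one]

lemma integrable_gibbsDensity (ψ : Y →ᵇ ℝ) : Integrable (gibbsDensity κ ψ) (μ ⊗ₘ κ) := by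
  simpa using integrable_mul_gibbsDensity κ (μ ⊗ₘ κ) ψ (h := fun _ => 1) (C := 1)
    measurable_const (by simp)

lemma integral_gibbsDensity (ψ : Y →ᵇ ℝ) : ∫ z, gibbsDensity κ ψ z ∂(μ ⊗ₘ κ) = 1 := by
  simpa using integral_comp_fst_mul_gibbsDensity κ μ ψ (h := fun _ => 1) (C := 1)
    measurable_const (by simp)

lemma integrable_bcf (ψ : Y →ᵇ ℝ) : Integrable ψ ν :=
  Integrable.of_bound (measurable_bcf ψ).aestronglyMeasurable ‖ψ‖
    (ae_of_all _ fun y => ψ.norm_coe_le_norm y)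

lemma semiDual_le_add_norm_sub (ψ φ : Y →ᵇ ℝ) :
    semiDual μ κ ν ψ ≤ semiDual μ κ ν φ + 2 * ‖ψ - φ‖ := by
  have h1 : ∫ x, logPartition κ φ x ∂μ ≤ ∫ x, logPartition κ ψ x + ‖ψ - φ‖ ∂μ :=
    integral_mono (integrable_logPartition κ μ φ)
      ((integrable_logPartition κ μ ψ).add (integrable_const _)) fun x => by
        simpa [norm_sub_rev] using logPartition_le_add_norm_sub κ φ ψ x
  have h2 : ∫ y, ψ y ∂ν ≤ ∫ y, φ y + ‖ψ - φ‖ ∂ν :=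
    integral_mono (integrable_bcf ν ψ) ((integrable_bcf ν φ).add (integrable_const _)) fun y => by
      have := (le_abs_self _).trans ((ψ - φ).norm_coe_le_norm y)
      simp only [BoundedContinuousFunction.sub_apply] at this
      linarith
  rw [integral_add (integrable_logPartition κ μ ψ) (integrable_const _)] at h1
  rw [integral_add (integrable_bcf ν φ) (integrable_const _)] at h2
  simp only [integral_const, probReal_univ, one_smul] at h1 h2
  unfold semiDual
  linarith

lemma continuous_semiDual : Continuous (semiDual μ κ ν) := by
  refine (LipschitzWith.of_le_add_mul 2 fun ψ φ => ?_).continuous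
  rw [dist_eq_norm]
  exact semiDual_le_add_norm_sub κ μ ν ψ φ

/-- Lower bound on the increments of the semi-dual functional, with the expected first-order term. -/
lemma semiDual_add_ge (ψ h : Y →ᵇ ℝ) (hh : ‖h‖ ≤ 1) :
    semiDual μ κ ν ψ + ((∫ y, h y ∂ν) - ∫ z, h z.2 * gibbsDensity κ ψ z ∂(μ ⊗ₘ κ)) - ‖h‖ ^ 2 ≤
      semiDual μ κ ν (ψ + h) := by
  have hint : Integrable (fun z : X × Y => h z.2 * gibbsDensity κ ψ z) (μ ⊗ₘ κ) :=
    integrable_mul_gibbsDensity κ _ ψ ((measurable_bcf h).comp measurable_snd)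
      fun z => h.norm_coe_le_norm z.2
  have key : ∀ x, logPartition κ (ψ + h) x ≤
      logPartition κ ψ x + ((∫ y, h y * gibbsDensity κ ψ (x, y) ∂κ x) + ‖h‖ ^ 2) := by
    intro x
    have i1 : Integrable (fun y => h y * gibbsDensity κ ψ (x, y)) (κ x) := by
      have := integrable_mul_gibbsDensity κ ((κ x).map (Prod.mk x)) ψ
        ((measurable_bcf h).comp measurable_snd) (fun z => h.norm_coe_le_norm z.2)
      exact this.comp_measurable measurable_prodMk_left
    have i2 : Integrable (fun y => gibbsDensity κ ψ (x, y)) (κ x) := by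
      by_contra hc
      have := integral_gibbsDensity_kernel κ ψ x
      rw [integral_undef hc] at this
      exact zero_ne_one this
    have e1 : ∫ y, Real.exp ((ψ + h) y) ∂κ x =
        Real.exp (logPartition κ ψ x) * ∫ y, Real.exp (h y) * gibbsDensity κ ψ (x, y) ∂κ x := by
      rw [← integral_const_mul]
      refine integral_congr_ae (ae_of_all _ fun y => ?_)
      simp only [gibbsDensity, BoundedContinuousFunction.add_apply, ← Real.exp_add]
      congr 1; ring
    have e2 : ∫ y, Real.exp (h y) * gibbsDensity κ ψ (x, y) ∂κ x ≤
        ∫ y, (gibbsDensity κ ψ (x, y) + h y * gibbsDensity κ ψ (x, y))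
          + ‖h‖ ^ 2 * gibbsDensity κ ψ (x, y) ∂κ x := by
      refine integral_mono_of_nonneg (ae_of_all _ fun y => ?_) ((i2.add i1).add (i2.const_mul _))
        (ae_of_all _ fun y => ?_)
      · exact mul_nonneg (Real.exp_pos _).le (gibbsDensity_pos κ ψ _).le
      · have hb : |h y| ≤ ‖h‖ := h.norm_coe_le_norm y
        have h1 := (abs_le.1 (Real.abs_exp_sub_one_sub_id_le (hb.trans hh))).2
        have h2 : (h y) ^ 2 ≤ ‖h‖ ^ 2 := sq_le_sq' (by linarith [(abs_le.1 hb).1]) (abs_le.1 hb).2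
        have := mul_le_mul_of_nonneg_right
          (show Real.exp (h y) ≤ 1 + h y + ‖h‖ ^ 2 by linarith) (gibbsDensity_pos κ ψ (x, y)).le
        simp only
        linarith
    rw [integral_add (by exact i2.add i1) (i2.const_mul _), integral_add i2 i1, integral_const_mul,
      integral_gibbsDensity_kernel, mul_one] at e2
    rw [← Real.exp_le_exp, Real.exp_add, exp_logPartition, e1]
    refine mul_le_mul_of_nonneg_left (e2.trans ?_) (Real.exp_pos _).le
    refine le_trans (le_of_eq ?_) (Real.add_one_le_exp _)
    ring
  have i3 : Integrable (fun x => ∫ y, h y * gibbsDensity κ ψ (x, y) ∂κ x) μ :=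
    hint.integral_compProd
  have hL := integral_mono (integrable_logPartition κ μ (ψ + h))
    ((integrable_logPartition κ μ ψ).add (i3.add (integrable_const (‖h‖ ^ 2)))) key
  rw [integral_add' (integrable_logPartition κ μ ψ) (i3.add (integrable_const (‖h‖ ^ 2))),
    integral_add' i3 (integrable_const (‖h‖ ^ 2)), integral_const, probReal_univ, one_smul] at hL
  rw [Measure.integral_compProd hint]
  unfold semiDual
  simp only [BoundedContinuousFunction.add_apply]
  rw [integral_add (integrable_bcf ν ψ) (integrable_bcf ν h)]
  linarith

lemma logPartition_half_add_le (ψ φ : Y →ᵇ ℝ) (x : X) :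
    logPartition κ ((2⁻¹ : ℝ) • (ψ + φ)) x ≤
      2⁻¹ * (logPartition κ ψ x + logPartition κ φ x) +
        ((∫ y, √(gibbsDensity κ ψ (x, y)) * √(gibbsDensity κ φ (x, y)) ∂κ x) - 1) := by
  have e1 : ∫ y, Real.exp (((2⁻¹ : ℝ) • (ψ + φ)) y) ∂κ x =
      Real.exp (2⁻¹ * (logPartition κ ψ x + logPartition κ φ x)) *
        ∫ y, √(gibbsDensity κ ψ (x, y)) * √(gibbsDensity κ φ (x, y)) ∂κ x := by
    rw [← integral_const_mul]
    refine integral_congr_ae (ae_of_all _ fun y => ?_)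
    simp only [gibbsDensity, BoundedContinuousFunction.add_apply,
      BoundedContinuousFunction.smul_apply, Real.sqrt_eq_rpow, ← Real.exp_mul, ← Real.exp_add,
      smul_eq_mul]
    congr 1; ring
  rw [← Real.exp_le_exp, Real.exp_add, exp_logPartition, e1]
  refine mul_le_mul_of_nonneg_left ?_ (Real.exp_pos _).le
  refine le_trans (le_of_eq ?_) (Real.add_one_le_exp _)
  ring

/-- Quantitative concavity of the semi-dual functional, in terms of the squared Hellinger distance
of the Gibbs densities. -/
lemma integral_sq_sqrt_gibbsDensity_sub_le {S : ℝ} (hS : ∀ ψ, semiDual μ κ ν ψ ≤ S)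
    (ψ φ : Y →ᵇ ℝ) :
    ∫ z, (√(gibbsDensity κ ψ z) - √(gibbsDensity κ φ z)) ^ 2 ∂(μ ⊗ₘ κ) ≤
      2 * S - semiDual μ κ ν ψ - semiDual μ κ ν φ := by
  have hg := integrable_gibbsDensity κ μ
  have hg1 := integral_gibbsDensity κ μ
  have hm : ∀ φ : Y →ᵇ ℝ, Measurable fun z => √(gibbsDensity κ φ z) := fun φ =>
    (measurable_gibbsDensity κ φ).sqrt
  have hi : Integrable (fun z => √(gibbsDensity κ ψ z) * √(gibbsDensity κ φ z)) (μ ⊗ₘ κ) := by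
    refine ((hg ψ).add (hg φ)).mono' ((hm ψ).mul (hm φ)).aestronglyMeasurable
      (ae_of_all _ fun z => ?_)
    have h1 := Real.sq_sqrt (gibbsDensity_pos κ ψ z).le
    have h2 := Real.sq_sqrt (gibbsDensity_pos κ φ z).le
    rw [Real.norm_eq_abs, abs_of_nonneg (by positivity), Pi.add_apply]
    nlinarith [sq_nonneg (√(gibbsDensity κ ψ z) - √(gibbsDensity κ φ z)),
      gibbsDensity_pos κ ψ z, gibbsDensity_pos κ φ z]
  have e1 : ∫ z, (√(gibbsDensity κ ψ z) - √(gibbsDensity κ φ z)) ^ 2 ∂(μ ⊗ₘ κ) =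
      2 - 2 * ∫ z, √(gibbsDensity κ ψ z) * √(gibbsDensity κ φ z) ∂(μ ⊗ₘ κ) := by
    have : ∀ z, (√(gibbsDensity κ ψ z) - √(gibbsDensity κ φ z)) ^ 2 =
        (gibbsDensity κ ψ z + gibbsDensity κ φ z) -
          2 * (√(gibbsDensity κ ψ z) * √(gibbsDensity κ φ z)) := fun z => by
      have h1 := Real.sq_sqrt (gibbsDensity_pos κ ψ z).le
      have h2 := Real.sq_sqrt (gibbsDensity_pos κ φ z).le
      linarith
    simp_rw [this]
    rw [integral_sub (by exact (hg ψ).add (hg φ)) (hi.const_mul 2), integral_add (hg ψ) (hg φ),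
      integral_const_mul, hg1, hg1]
    norm_num
  have i3 : Integrable
      (fun x => ∫ y, √(gibbsDensity κ ψ (x, y)) * √(gibbsDensity κ φ (x, y)) ∂κ x) μ :=
    hi.integral_compProd
  have iL := integrable_logPartition κ μ
  have hL := integral_mono (iL ((2⁻¹ : ℝ) • (ψ + φ)))
    ((((iL ψ).add (iL φ)).const_mul 2⁻¹).add (i3.sub (integrable_const 1)))
    (logPartition_half_add_le κ ψ φ)
  rw [integral_add' (((iL ψ).add (iL φ)).const_mul 2⁻¹) (i3.sub (integrable_const 1)),
    integral_sub' i3 (integrable_const 1), integral_const_mul, integral_add' (iL ψ) (iL φ),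
    integral_const, probReal_univ, one_smul] at hL
  have hD := hS ((2⁻¹ : ℝ) • (ψ + φ))
  rw [e1, Measure.integral_compProd hi]
  unfold semiDual at hD ⊢
  simp only [BoundedContinuousFunction.add_apply, BoundedContinuousFunction.smul_apply,
    smul_eq_mul] at hD
  rw [integral_const_mul, integral_add (integrable_bcf ν ψ) (integrable_bcf ν φ)] at hD
  linarith

/-- Every potential can be rescaled so that the semi-dual functional does not decrease and attains
its maximum over the segment joining the potential to zero. -/
lemma exists_ray_maximal (ψ : Y →ᵇ ℝ) : ∃ φ : Y →ᵇ ℝ, semiDual μ κ ν ψ ≤ semiDual μ κ ν φ ∧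
    ∀ t ∈ Icc (0 : ℝ) 1, semiDual μ κ ν (t • φ) ≤ semiDual μ κ ν φ := by
  have hc : Continuous fun s : ℝ => semiDual μ κ ν (s • ψ) :=
    (continuous_semiDual κ μ ν).comp (continuous_id.smul continuous_const)
  obtain ⟨s, hs, hmax⟩ := isCompact_Icc.exists_isMaxOn (nonempty_Icc.2 (zero_le_one (α := ℝ)))
    hc.continuousOn
  refine ⟨s • ψ, by simpa using hmax (right_mem_Icc.2 zero_le_one), fun t ht => ?_⟩
  rw [smul_smul]
  exact hmax ⟨mul_nonneg ht.1 hs.1, mul_le_one₀ ht.2 hs.1 hs.2⟩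

lemma semiDual_add_smul_ge (ψ h : Y →ᵇ ℝ) {t : ℝ} (ht : 0 < t) (hle : t ≤ (‖h‖ + 1)⁻¹) :
    semiDual μ κ ν ψ + t * ((∫ y, h y ∂ν) - ∫ z, h z.2 * gibbsDensity κ ψ z ∂(μ ⊗ₘ κ))
      - t ^ 2 * ‖h‖ ^ 2 ≤ semiDual μ κ ν (ψ + t • h) := by
  have := semiDual_add_ge κ μ ν ψ (t • h) (norm_smul_le_one_of_le ht h hle)
  simp only [BoundedContinuousFunction.smul_apply, smul_eq_mul, mul_assoc, integral_const_mul,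
    norm_smul, Real.norm_eq_abs, abs_of_pos ht, mul_pow] at this
  linarith

lemma integral_mul_gibbsDensity_le_of_ray_maximal (ψ : Y →ᵇ ℝ)
    (hψ : ∀ t ∈ Icc (0 : ℝ) 1, semiDual μ κ ν (t • ψ) ≤ semiDual μ κ ν ψ) :
    ∫ z, ψ z.2 * gibbsDensity κ ψ z ∂(μ ⊗ₘ κ) ≤ ∫ y, ψ y ∂ν := by
  have hn := norm_nonneg ψ
  refine sub_nonpos.1 (nonpos_of_forall_mul_le_sq_mul (b := ‖ψ‖ ^ 2)
    (show 0 < (‖ψ‖ + 1)⁻¹ by positivity) fun t ht hle => ?_)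
  have h1 := semiDual_add_smul_ge κ μ ν ψ (-ψ) ht (by rwa [norm_neg])
  have ht1 : t ≤ 1 := hle.trans (inv_le_one_of_one_le₀ (by linarith))
  have h2 := hψ (1 - t) ⟨by linarith, by linarith⟩
  rw [show (1 - t) • ψ = ψ + t • -ψ by
    ext y
    simp only [BoundedContinuousFunction.smul_apply, BoundedContinuousFunction.add_apply,
      BoundedContinuousFunction.neg_apply, smul_eq_mul]
    ring] at h2
  simp only [BoundedContinuousFunction.neg_apply, neg_mul, integral_neg, norm_neg] at h1
  linarith

/-- The entropy of the Gibbs tilt of a ray-maximal potential is bounded by its semi-dual value. -/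
lemma lintegral_klFun_gibbsDensity_le (ψ : Y →ᵇ ℝ)
    (hψ : ∀ t ∈ Icc (0 : ℝ) 1, semiDual μ κ ν (t • ψ) ≤ semiDual μ κ ν ψ) :
    ∫⁻ z, ENNReal.ofReal (InformationTheory.klFun (gibbsDensity κ ψ z)) ∂(μ ⊗ₘ κ) ≤
      ENNReal.ofReal (semiDual μ κ ν ψ) := by
  have i1 : Integrable (fun z : X × Y => ψ z.2 * gibbsDensity κ ψ z) (μ ⊗ₘ κ) :=
    integrable_mul_gibbsDensity κ _ ψ ((measurable_bcf ψ).comp measurable_snd)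
      fun z => ψ.norm_coe_le_norm z.2
  have i2 : Integrable (fun z : X × Y => logPartition κ ψ z.1 * gibbsDensity κ ψ z) (μ ⊗ₘ κ) :=
    integrable_mul_gibbsDensity κ _ ψ ((measurable_logPartition κ ψ).comp measurable_fst)
      fun z => abs_logPartition_le κ ψ z.1
  have i3 := integrable_gibbsDensity κ μ ψ
  have i4 : Integrable (fun z : X × Y => 1 - gibbsDensity κ ψ z) (μ ⊗ₘ κ) :=
    (integrable_const 1).sub i3
  have i5 : Integrable (fun z : X × Y => ψ z.2 * gibbsDensity κ ψ z -
      logPartition κ ψ z.1 * gibbsDensity κ ψ z) (μ ⊗ₘ κ) := i1.sub i2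
  have e : ∀ z, InformationTheory.klFun (gibbsDensity κ ψ z) =
      (ψ z.2 * gibbsDensity κ ψ z - logPartition κ ψ z.1 * gibbsDensity κ ψ z) +
        (1 - gibbsDensity κ ψ z) := fun z => by
    rw [InformationTheory.klFun, show Real.log (gibbsDensity κ ψ z) =
      ψ z.2 - logPartition κ ψ z.1 from Real.log_exp _]
    ring
  rw [← ofReal_integral_eq_lintegral_ofReal ((i5.add i4).congr (ae_of_all _ fun z => (e z).symm))
    (ae_of_all _ fun z => InformationTheory.klFun_nonneg (gibbsDensity_pos κ ψ z).le)]
  refine ENNReal.ofReal_le_ofReal ?_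
  simp_rw [e]
  rw [integral_add i5 i4, integral_sub i1 i2, integral_sub (integrable_const 1) i3,
    integral_comp_fst_mul_gibbsDensity κ μ ψ (measurable_logPartition κ ψ)
      (abs_logPartition_le κ ψ), integral_gibbsDensity, integral_const, probReal_univ, one_smul]
  have := integral_mul_gibbsDensity_le_of_ray_maximal κ μ ν ψ hψ
  unfold semiDual
  linarith

/-- If the semi-dual functional is bounded above by `S`, some coupling of `μ` and `ν` has relative
entropy at most `S` with respect to `μ ⊗ₘ κ`. -/
theorem exists_coupling_density_of_semiDual_le [HasOuterApproxClosed Y] {S : ℝ}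
    (hS : ∀ ψ, semiDual μ κ ν ψ ≤ S) :
    ∃ f : X × Y → ℝ, Measurable f ∧ (∀ z, 0 ≤ f z) ∧
      ((μ ⊗ₘ κ).withDensity fun z => ENNReal.ofReal (f z)).map Prod.fst = μ ∧
      ((μ ⊗ₘ κ).withDensity fun z => ENNReal.ofReal (f z)).map Prod.snd = ν ∧
      Integrable (fun z => f z * Real.log (f z)) (μ ⊗ₘ κ) ∧
      ∫ z, f z * Real.log (f z) ∂(μ ⊗ₘ κ) ≤ S := by
  set P := μ ⊗ₘ κ with hP
  have hbdd : BddAbove (range (semiDual μ κ ν)) := ⟨S, by rintro _ ⟨ψ, rfl⟩; exact hS ψ⟩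
  set S' := ⨆ ψ, semiDual μ κ ν ψ with hS'
  have hle' : ∀ ψ, semiDual μ κ ν ψ ≤ S' := fun ψ => le_ciSup hbdd ψ
  have hex : ∀ k : ℕ, ∃ ψ : Y →ᵇ ℝ, S' - 1 / ((k : ℝ) + 1) < semiDual μ κ ν ψ ∧
      ∀ t ∈ Icc (0 : ℝ) 1, semiDual μ κ ν (t • ψ) ≤ semiDual μ κ ν ψ := fun k => by
    obtain ⟨φ, hφ⟩ := exists_lt_of_lt_ciSup
      (show S' - 1 / ((k : ℝ) + 1) < ⨆ ψ, semiDual μ κ ν ψ from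
        sub_lt_self _ Nat.one_div_pos_of_nat)
    obtain ⟨ψ, h1, h2⟩ := exists_ray_maximal κ μ ν φ
    exact ⟨ψ, hφ.trans_le h1, h2⟩
  choose ψ hψlt hψray using hex
  have hDlim : Tendsto (fun k => S' - semiDual μ κ ν (ψ k)) atTop (𝓝 0) :=
    squeeze_zero (fun k => sub_nonneg.2 (hle' _)) (fun k => by linarith [hψlt k])
      tendsto_one_div_add_atTop_nhds_zero_nat
  have hsq : ∀ k z, √(gibbsDensity κ (ψ k) z) ^ 2 = gibbsDensity κ (ψ k) z := fun k z =>
    Real.sq_sqrt (gibbsDensity_pos κ (ψ k) z).le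
  have hu : ∀ k, MemLp (fun z => √(gibbsDensity κ (ψ k) z)) 2 P := fun k => by
    refine (memLp_two_iff_integrable_sq
      (measurable_gibbsDensity κ (ψ k)).sqrt.aestronglyMeasurable).2 ?_
    simp_rw [hsq]
    exact integrable_gibbsDensity κ μ (ψ k)
  obtain ⟨g, hgm, hgi, ⟨ns, hns, hae⟩, hlim⟩ := exists_limit_of_cauchy_sq hu hDlim fun k l =>
    (integral_sq_sqrt_gibbsDensity_sub_le κ μ ν hle' (ψ k) (ψ l)).trans (by linarith)
  simp_rw [hsq] at hlim
  have hfm : Measurable fun z => g z ^ 2 := hgm.pow_const 2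
  have hone : ∫ z, g z ^ 2 ∂P = 1 := by
    have := hlim (fun _ => 1) 1 measurable_const (by simp)
    simp_rw [one_mul, hP, integral_gibbsDensity] at this
    exact tendsto_nhds_unique this tendsto_const_nhds
  set Q := P.withDensity fun z => ENNReal.ofReal (g z ^ 2) with hQ
  have hQint : ∀ h : X × Y → ℝ, ∫ z, h z ∂Q = ∫ z, h z * g z ^ 2 ∂P := fun h => by
    rw [hQ, integral_withDensity_eq_integral_toReal_smul hfm.ennreal_ofReal
      (ae_of_all _ fun _ => ENNReal.ofReal_lt_top)]
    refine integral_congr_ae (ae_of_all _ fun z => ?_)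
    simp only [ENNReal.toReal_ofReal (sq_nonneg (g z)), smul_eq_mul]
    ring
  have : IsFiniteMeasure Q := isFiniteMeasure_withDensity_ofReal hgi.2
  have hfst : Q.map Prod.fst = μ := by
    have : IsFiniteMeasure (Q.map Prod.fst) := Measure.isFiniteMeasure_map Q _
    refine Measure.ext fun A hA => (measureReal_eq_measureReal_iff).1 ?_
    have hind : Measurable (A.indicator (1 : X → ℝ)) := measurable_const.indicator hA
    rw [← integral_indicator_one hA, ← integral_indicator_one hA,
      integral_map measurable_fst.aemeasurable hind.aestronglyMeasurable, hQint]
    have hb : ∀ x, |A.indicator (1 : X → ℝ) x| ≤ 1 := fun x => by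
      by_cases hx : x ∈ A <;> simp [hx]
    have := hlim _ 1 (hind.comp measurable_fst) fun z => hb z.1
    simp only [Function.comp_apply, hP, integral_comp_fst_mul_gibbsDensity κ μ _ hind hb] at this
    exact tendsto_nhds_unique this tendsto_const_nhds
  have hopt : ∀ h : Y →ᵇ ℝ, ∫ y, h y ∂ν ≤ ∫ z, h z.2 * g z ^ 2 ∂P := fun h => by
    have hn := norm_nonneg h
    refine sub_nonpos.1 (nonpos_of_forall_mul_le_sq_mul (b := ‖h‖ ^ 2)
      (show 0 < (‖h‖ + 1)⁻¹ by positivity) fun t ht hle => ?_)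
    have hl := hlim (fun z => h z.2) ‖h‖ ((measurable_bcf h).comp measurable_snd)
      fun z => h.norm_coe_le_norm z.2
    have hl2 := hDlim.add_const (t ^ 2 * ‖h‖ ^ 2)
    rw [zero_add] at hl2
    refine le_of_tendsto_of_tendsto' ((tendsto_const_nhds.sub hl).const_mul t) hl2 fun k => ?_
    have h1 := semiDual_add_smul_ge κ μ ν (ψ k) h ht hle
    have h2 := hle' (ψ k + t • h)
    linarith
  have hsnd : Q.map Prod.snd = ν := by
    have : IsFiniteMeasure (Q.map Prod.snd) := Measure.isFiniteMeasure_map Q _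
    refine ext_of_forall_integral_eq_of_IsFiniteMeasure fun h => ?_
    rw [integral_map measurable_snd.aemeasurable (measurable_bcf h).aestronglyMeasurable, hQint]
    refine le_antisymm ?_ (hopt h)
    have := hopt (-h)
    simp only [BoundedContinuousFunction.neg_apply, neg_mul, integral_neg] at this
    linarith
  have hS'0 : 0 ≤ S' := by simpa [semiDual_zero] using hle' 0
  have hkl : ∫⁻ z, ENNReal.ofReal (InformationTheory.klFun (g z ^ 2)) ∂P ≤ ENNReal.ofReal S' := by
    have hc := InformationTheory.continuous_klFun
    calc ∫⁻ z, ENNReal.ofReal (InformationTheory.klFun (g z ^ 2)) ∂P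
        = ∫⁻ z, liminf (fun k => ENNReal.ofReal
            (InformationTheory.klFun (gibbsDensity κ (ψ (ns k)) z))) atTop ∂P := by
          refine lintegral_congr_ae ?_
          filter_upwards [hae] with z hz
          have h1 := hz.pow 2
          simp_rw [hsq] at h1
          exact (((ENNReal.continuous_ofReal.comp hc).tendsto _).comp h1).liminf_eq.symm
      _ ≤ liminf (fun k => ∫⁻ z, ENNReal.ofReal
            (InformationTheory.klFun (gibbsDensity κ (ψ (ns k)) z)) ∂P) atTop :=
          lintegral_liminf_le fun k =>
            (hc.measurable.comp (measurable_gibbsDensity κ (ψ (ns k)))).ennreal_ofReal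
      _ ≤ ENNReal.ofReal S' := by
          refine liminf_le_of_le ?_ fun b hb => ?_
          · isBoundedDefault
          · obtain ⟨k, hk⟩ := hb.exists
            exact hk.trans ((lintegral_klFun_gibbsDensity_le κ μ ν (ψ (ns k)) (hψray _)).trans
              (ENNReal.ofReal_le_ofReal (hle' _)))
  have hklm : AEStronglyMeasurable (fun z => InformationTheory.klFun (g z ^ 2)) P :=
    (InformationTheory.continuous_klFun.measurable.comp hfm).aestronglyMeasurable
  have hkl0 : 0 ≤ᵐ[P] fun z => InformationTheory.klFun (g z ^ 2) :=
    ae_of_all _ fun z => InformationTheory.klFun_nonneg (sq_nonneg _)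
  have hkli : Integrable (fun z => InformationTheory.klFun (g z ^ 2)) P :=
    (lintegral_ofReal_ne_top_iff_integrable hklm hkl0).1
      (hkl.trans_lt ENNReal.ofReal_lt_top).ne
  have hkle : ∫ z, InformationTheory.klFun (g z ^ 2) ∂P ≤ S' := by
    rw [integral_eq_lintegral_of_nonneg_ae hkl0 hklm]
    exact ENNReal.toReal_le_of_le_ofReal hS'0 hkl
  have hdec : (fun z => g z ^ 2 * Real.log (g z ^ 2)) =
      fun z => InformationTheory.klFun (g z ^ 2) + (g z ^ 2 - 1) := by
    funext z
    rw [InformationTheory.klFun]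
    ring
  have hg1 : Integrable (fun z => g z ^ 2 - 1) P := hgi.sub (integrable_const 1)
  refine ⟨fun z => g z ^ 2, hfm, fun z => sq_nonneg _, hfst, hsnd, ?_, ?_⟩
  · simp only [hdec]
    exact hkli.add hg1
  · simp only [hdec]
    rw [integral_add hkli hg1, integral_sub hgi (integrable_const 1), hone, integral_const,
      probReal_univ, one_smul, sub_self, add_zero]
    exact hkle.trans (ciSup_le hS)

end SemiDual


section RelativeEntropy

variable {X Y : Type*} [MeasurableSpace X] [MeasurableSpace Y] {m : Measure X} [SigmaFinite m]
  {κ : Kernel X Y} [IsMarkovKernel κ] {μ : Measure X} [IsProbabilityMeasure μ]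

lemma compProd_eq_withDensity_rnDeriv (hμ : μ ≪ m) :
    μ ⊗ₘ κ = (m ⊗ₘ κ).withDensity fun z => μ.rnDeriv m z.1 := by
  have hρ := Measure.measurable_rnDeriv μ m
  refine Measure.ext_of_lintegral _ fun h hh => ?_
  have hρ1 : Measurable fun z : X × Y => μ.rnDeriv m z.1 := hρ.comp measurable_fst
  have hinner : Measurable fun x => ∫⁻ y, h (x, y) ∂κ x := hh.lintegral_kernel_prod_right'
  rw [Measure.lintegral_compProd hh,
    lintegral_withDensity_eq_lintegral_mul _ hρ1 hh,
    Measure.lintegral_compProd (hρ1.mul hh),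
    ← lintegral_rnDeriv_mul hμ hinner.aemeasurable]
  refine lintegral_congr fun x => ?_
  exact (lintegral_const_mul _ (hh.comp measurable_prodMk_left)).symm

lemma relEnt_of_integrable {α : Type*} [MeasurableSpace α] {q r : Measure α} (h : q ≪ r)
    (hi : Integrable (fun x => Real.log ((q.rnDeriv r x).toReal)) q) :
    relEnt q r = ((∫ x, Real.log ((q.rnDeriv r x).toReal) ∂q : ℝ) : EReal) :=
  if_pos ⟨h, hi⟩

lemma ac_and_integrable_of_relEnt_ne_top {α : Type*} [MeasurableSpace α] {q r : Measure α}
    (h : relEnt q r ≠ ⊤) :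
    q ≪ r ∧ Integrable (fun x => Real.log ((q.rnDeriv r x).toReal)) q := by
  by_contra hc
  exact h (if_neg hc)

/-- Chain rule: the relative entropy of a tilt of `μ ⊗ₘ κ` with first marginal `μ`. -/
lemma relEnt_withDensity_compProd [SigmaFinite (m ⊗ₘ κ)] (hμ : μ ≪ m)
    (hμi : Integrable (fun x => Real.log ((μ.rnDeriv m x).toReal)) μ)
    {f : X × Y → ℝ} (hf : Measurable f) (hf0 : ∀ z, 0 ≤ f z)
    (hfst : ((μ ⊗ₘ κ).withDensity fun z => ENNReal.ofReal (f z)).map Prod.fst = μ)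
    (hfi : Integrable (fun z => f z * Real.log (f z)) (μ ⊗ₘ κ)) :
    relEnt ((μ ⊗ₘ κ).withDensity fun z => ENNReal.ofReal (f z)) (m ⊗ₘ κ) =
      ((∫ x, Real.log ((μ.rnDeriv m x).toReal) ∂μ + ∫ z, f z * Real.log (f z) ∂(μ ⊗ₘ κ) : ℝ) :
        EReal) := by
  have hρ := Measure.measurable_rnDeriv μ m
  have hρ1 : Measurable fun z : X × Y => μ.rnDeriv m z.1 := hρ.comp measurable_fst
  have hQR : (μ ⊗ₘ κ).withDensity (fun z => ENNReal.ofReal (f z)) =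
      (m ⊗ₘ κ).withDensity ((fun z => μ.rnDeriv m z.1) * fun z => ENNReal.ofReal (f z)) := by
    rw [withDensity_mul _ hρ1 hf.ennreal_ofReal, ← compProd_eq_withDensity_rnDeriv hμ]
  have htop : ∀ᵐ z ∂(μ ⊗ₘ κ), ENNReal.ofReal (f z) < ⊤ :=
    ae_of_all _ fun _ => ENNReal.ofReal_lt_top
  have htoReal : ∀ z, (ENNReal.ofReal (f z)).toReal = f z := fun z =>
    ENNReal.toReal_ofReal (hf0 z)
  set Q := (μ ⊗ₘ κ).withDensity fun z => ENNReal.ofReal (f z) with hQ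
  have hac : Q ≪ m ⊗ₘ κ := hQR ▸ withDensity_absolutelyContinuous _ _
  have hder : ∀ᵐ z ∂Q, Q.rnDeriv (m ⊗ₘ κ) z = μ.rnDeriv m z.1 * ENNReal.ofReal (f z) := by
    refine hac.ae_le ?_
    rw [hQR]
    exact Measure.rnDeriv_withDensity _ (hρ1.mul hf.ennreal_ofReal)
  have hρpos : ∀ᵐ z ∂Q, 0 < μ.rnDeriv m z.1 ∧ μ.rnDeriv m z.1 < ⊤ := by
    refine ae_of_ae_map (f := Prod.fst) measurable_fst.aemeasurable
      (p := fun x => 0 < μ.rnDeriv m x ∧ μ.rnDeriv m x < ⊤) ?_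
    rw [hfst]
    exact (Measure.rnDeriv_pos hμ).and (hμ.ae_le (Measure.rnDeriv_lt_top μ m))
  have hfpos : ∀ᵐ z ∂Q, 0 < f z := by
    refine (ae_withDensity_iff hf.ennreal_ofReal).2 (ae_of_all _ fun z hz => ?_)
    exact ENNReal.ofReal_pos.1 (pos_iff_ne_zero.2 hz)
  have hlog : (fun z => Real.log ((Q.rnDeriv (m ⊗ₘ κ) z).toReal)) =ᵐ[Q]
      fun z => Real.log ((μ.rnDeriv m z.1).toReal) + Real.log (f z) := by
    filter_upwards [hder, hρpos, hfpos] with z h1 h2 h3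
    rw [h1, ENNReal.toReal_mul, htoReal,
      Real.log_mul (ENNReal.toReal_pos h2.1.ne' h2.2.ne).ne' h3.ne']
  have hlm : AEStronglyMeasurable (fun x => Real.log ((μ.rnDeriv m x).toReal))
      (Q.map Prod.fst) := hρ.ennreal_toReal.log.aestronglyMeasurable
  have i1 : Integrable (fun z => Real.log ((μ.rnDeriv m z.1).toReal)) Q :=
    (integrable_map_measure hlm measurable_fst.aemeasurable).1 (by rwa [hfst])
  have i2 : Integrable (fun z => Real.log (f z)) Q := by
    rw [hQ, integrable_withDensity_iff hf.ennreal_ofReal htop]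
    simp_rw [htoReal, mul_comm (Real.log _)]
    exact hfi
  have e1 : ∫ z, Real.log ((μ.rnDeriv m z.1).toReal) ∂Q =
      ∫ x, Real.log ((μ.rnDeriv m x).toReal) ∂μ := by
    rw [← integral_map measurable_fst.aemeasurable hlm, hfst]
  have e2 : ∫ z, Real.log (f z) ∂Q = ∫ z, f z * Real.log (f z) ∂(μ ⊗ₘ κ) := by
    rw [hQ, integral_withDensity_eq_integral_toReal_smul hf.ennreal_ofReal htop]
    simp_rw [htoReal, smul_eq_mul]
  rw [relEnt_of_integrable hac ((i1.add i2).congr hlog.symm), integral_congr_ae hlog,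
    integral_add i1 i2, e1, e2]

/-- Weak duality. -/
lemma entropy_add_semiDual_le [TopologicalSpace Y] [BorelSpace Y] [SigmaFinite (m ⊗ₘ κ)]
    {ν : Measure Y} (hμ : μ ≪ m)
    (hμi : Integrable (fun x => Real.log ((μ.rnDeriv m x).toReal)) μ) (ψ : Y →ᵇ ℝ)
    {q : Measure (X × Y)} [IsProbabilityMeasure q]
    (hfst : q.map Prod.fst = μ) (hsnd : q.map Prod.snd = ν) (hq : q ≪ m ⊗ₘ κ)
    (hqi : Integrable (fun z => Real.log ((q.rnDeriv (m ⊗ₘ κ) z).toReal)) q) :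
    ∫ x, Real.log ((μ.rnDeriv m x).toReal) ∂μ + semiDual μ κ ν ψ ≤
      ∫ z, Real.log ((q.rnDeriv (m ⊗ₘ κ) z).toReal) ∂q := by
  have : IsProbabilityMeasure ν := hsnd ▸ Measure.isProbabilityMeasure_map (by fun_prop)
  have hρ := Measure.measurable_rnDeriv μ m
  have hρ1 : Measurable fun z : X × Y => μ.rnDeriv m z.1 := hρ.comp measurable_fst
  set ρ := μ.rnDeriv m with hρdef
  set d := q.rnDeriv (m ⊗ₘ κ) with hd
  have hdm : Measurable d := Measure.measurable_rnDeriv _ _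
  have hgm := measurable_gibbsDensity κ ψ
  set h : X × Y → ℝ := fun z => (ρ z.1).toReal * gibbsDensity κ ψ z with hh
  have hhm : Measurable h := hρ1.ennreal_toReal.mul hgm
  have hh0 : ∀ z, 0 ≤ h z := fun z =>
    mul_nonneg ENNReal.toReal_nonneg (gibbsDensity_pos κ ψ z).le
  have hmass : ∫⁻ z, ENNReal.ofReal (h z) ∂(m ⊗ₘ κ) ≤ 1 := by
    calc ∫⁻ z, ENNReal.ofReal (h z) ∂(m ⊗ₘ κ)
        ≤ ∫⁻ z, ((fun z : X × Y => ρ z.1) * fun z => ENNReal.ofReal (gibbsDensity κ ψ z)) z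
            ∂(m ⊗ₘ κ) := by
          refine lintegral_mono fun z => ?_
          simp only [hh, Pi.mul_apply]
          rw [ENNReal.ofReal_mul ENNReal.toReal_nonneg]
          gcongr
          exact ENNReal.ofReal_toReal_le
      _ = ∫⁻ z, ENNReal.ofReal (gibbsDensity κ ψ z) ∂(μ ⊗ₘ κ) := by
          rw [compProd_eq_withDensity_rnDeriv hμ,
            lintegral_withDensity_eq_lintegral_mul _ hρ1 hgm.ennreal_ofReal]
      _ = 1 := by
          rw [← ofReal_integral_eq_lintegral_ofReal (integrable_gibbsDensity κ μ ψ)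
            (ae_of_all _ fun z => (gibbsDensity_pos κ ψ z).le), integral_gibbsDensity,
            ENNReal.ofReal_one]
  have hratio0 : ∀ z, 0 ≤ h z / (d z).toReal := fun z =>
    div_nonneg (hh0 z) ENNReal.toReal_nonneg
  have hratiom : Measurable fun z => h z / (d z).toReal := hhm.div hdm.ennreal_toReal
  have hratio : ∫⁻ z, ENNReal.ofReal (h z / (d z).toReal) ∂q ≤ 1 := by
    rw [← lintegral_rnDeriv_mul hq hratiom.ennreal_ofReal.aemeasurable]
    refine le_trans (lintegral_mono_ae ?_) hmass
    filter_upwards [Measure.rnDeriv_lt_top q (m ⊗ₘ κ)] with z hz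
    rw [← ENNReal.ofReal_toReal hz.ne, ← ENNReal.ofReal_mul ENNReal.toReal_nonneg]
    refine ENNReal.ofReal_le_ofReal ?_
    rw [mul_div_left_comm]
    exact mul_le_of_le_one_right (hh0 z) (div_self_le_one _)
  have hratioi : Integrable (fun z => h z / (d z).toReal) q :=
    (lintegral_ofReal_ne_top_iff_integrable hratiom.aestronglyMeasurable
      (ae_of_all _ hratio0)).1 (hratio.trans_lt ENNReal.one_lt_top).ne
  have hratiole : ∫ z, h z / (d z).toReal ∂q ≤ 1 := by
    rw [integral_eq_lintegral_of_nonneg_ae (ae_of_all _ hratio0) hratiom.aestronglyMeasurable]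
    exact ENNReal.toReal_le_of_le_ofReal zero_le_one (by simpa using hratio)
  have hρpos : ∀ᵐ z ∂q, 0 < ρ z.1 ∧ ρ z.1 < ⊤ := by
    refine ae_of_ae_map (f := Prod.fst) measurable_fst.aemeasurable
      (p := fun x => 0 < ρ x ∧ ρ x < ⊤) ?_
    rw [hfst]
    exact (Measure.rnDeriv_pos hμ).and (hμ.ae_le (Measure.rnDeriv_lt_top μ m))
  have i1 : Integrable (fun z : X × Y => Real.log ((ρ z.1).toReal)) q := by
    refine Integrable.comp_measurable (f := Prod.fst) (g := fun x => Real.log ((ρ x).toReal)) ?_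
      measurable_fst
    rwa [hfst]
  have i2 : Integrable (fun z : X × Y => ψ z.2) q :=
    Integrable.comp_measurable (f := Prod.snd) (g := ψ) (hsnd ▸ integrable_bcf ν ψ) measurable_snd
  have i3 : Integrable (fun z : X × Y => logPartition κ ψ z.1) q :=
    Integrable.comp_measurable (f := Prod.fst) (g := logPartition κ ψ)
      (hfst ▸ integrable_logPartition κ μ ψ) measurable_fst
  have i4 : Integrable (fun z : X × Y => ψ z.2 - logPartition κ ψ z.1) q := i2.sub i3
  have e1 : ∫ z, Real.log ((ρ z.1).toReal) ∂q = ∫ x, Real.log ((ρ x).toReal) ∂μ := by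
    rw [← hfst, integral_map measurable_fst.aemeasurable
      hρ.ennreal_toReal.log.aestronglyMeasurable]
  have e2 : ∫ z, ψ z.2 ∂q = ∫ y, ψ y ∂ν := by
    rw [← hsnd, integral_map measurable_snd.aemeasurable (measurable_bcf ψ).aestronglyMeasurable]
  have e3 : ∫ z, logPartition κ ψ z.1 ∂q = ∫ x, logPartition κ ψ x ∂μ := by
    rw [← hfst, integral_map measurable_fst.aemeasurable
      (measurable_logPartition κ ψ).aestronglyMeasurable]
  have i5 : Integrable (fun z => h z / (d z).toReal - 1) q := hratioi.sub (integrable_const 1)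
  have hle : ∫ z, Real.log ((ρ z.1).toReal) + (ψ z.2 - logPartition κ ψ z.1) ∂q ≤
      ∫ z, Real.log ((d z).toReal) + (h z / (d z).toReal - 1) ∂q := by
    refine integral_mono_ae (i1.add i4) (hqi.add i5) ?_
    filter_upwards [hρpos, Measure.rnDeriv_pos hq, hq.ae_le (Measure.rnDeriv_lt_top q (m ⊗ₘ κ))]
      with z h1 h2 h3
    have hdz : 0 < (d z).toReal := ENNReal.toReal_pos h2.ne' h3.ne
    have hρz : 0 < (ρ z.1).toReal := ENNReal.toReal_pos h1.1.ne' h1.2.ne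
    have hhz : 0 < h z := mul_pos hρz (gibbsDensity_pos κ ψ z)
    have hk := Real.log_le_sub_one_of_pos (div_pos hhz hdz)
    rw [Real.log_div hhz.ne' hdz.ne', hh, Real.log_mul hρz.ne' (gibbsDensity_pos κ ψ z).ne',
      show Real.log (gibbsDensity κ ψ z) = ψ z.2 - logPartition κ ψ z.1 from Real.log_exp _] at hk
    linarith
  rw [integral_add i1 i4, integral_sub i2 i3, integral_add hqi i5,
    integral_sub hratioi (integrable_const 1), integral_const, probReal_univ, one_smul,
    e1, e2, e3] at hle
  unfold semiDual
  linarith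

/-- Strong duality for the entropic cost relative to `m ⊗ₘ κ`. -/
theorem entCost_compProd_eq [TopologicalSpace X] [BorelSpace X] [HasOuterApproxClosed X]
    {κ : Kernel X X} [IsMarkovKernel κ] [SigmaFinite (m ⊗ₘ κ)]
    {ν : Measure X} [IsProbabilityMeasure ν] (hμ : relEnt μ m ≠ ⊤) :
    entCost (m ⊗ₘ κ) μ ν =
      relEnt μ m + ⨆ ψ : X →ᵇ ℝ, ((semiDual μ κ ν ψ : ℝ) : EReal) := by
  obtain ⟨hac, hi⟩ := ac_and_integrable_of_relEnt_ne_top hμ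
  rw [relEnt_of_integrable hac hi]
  set c := ∫ x, Real.log ((μ.rnDeriv m x).toReal) ∂μ with hc
  apply le_antisymm
  · rcases eq_or_ne (⨆ ψ : X →ᵇ ℝ, ((semiDual μ κ ν ψ : ℝ) : EReal)) ⊤ with htop | htop
    · rw [htop, EReal.coe_add_top]
      exact le_top
    · have hbot : (⨆ ψ : X →ᵇ ℝ, ((semiDual μ κ ν ψ : ℝ) : EReal)) ≠ ⊥ := fun h =>
        EReal.coe_ne_bot _ (le_bot_iff.1
          (h ▸ le_iSup (fun ψ : X →ᵇ ℝ => ((semiDual μ κ ν ψ : ℝ) : EReal)) 0))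
      lift (⨆ ψ : X →ᵇ ℝ, ((semiDual μ κ ν ψ : ℝ) : EReal)) to ℝ using ⟨htop, hbot⟩ with S hS
      obtain ⟨f, hf, hf0, h1, h2, hfi, hle⟩ :=
        exists_coupling_density_of_semiDual_le κ μ ν (S := S) fun ψ => EReal.coe_le_coe_iff.1
          (hS ▸ le_iSup (fun ψ : X →ᵇ ℝ => ((semiDual μ κ ν ψ : ℝ) : EReal)) ψ)
      have hprob : IsProbabilityMeasure
          ((μ ⊗ₘ κ).withDensity fun z => ENNReal.ofReal (f z)) := by
        refine ⟨?_⟩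
        rw [← Set.preimage_univ (f := (Prod.fst : X × X → X)),
          ← Measure.map_apply measurable_fst MeasurableSet.univ, h1, measure_univ]
      have hcost : entCost (m ⊗ₘ κ) μ ν ≤
          relEnt ((μ ⊗ₘ κ).withDensity fun z => ENNReal.ofReal (f z)) (m ⊗ₘ κ) :=
        sInf_le ⟨_, hprob, h1, h2, rfl⟩
      rw [relEnt_withDensity_compProd hac hi hf hf0 h1 hfi] at hcost
      refine hcost.trans ?_
      rw [← EReal.coe_add, EReal.coe_le_coe_iff]
      linarith
  · refine le_sInf ?_
    rintro _ ⟨q, hqp, h1, h2, rfl⟩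
    by_cases hq : relEnt q (m ⊗ₘ κ) = ⊤
    · rw [hq]
      exact le_top
    · obtain ⟨hqac, hqi⟩ := ac_and_integrable_of_relEnt_ne_top hq
      rw [relEnt_of_integrable hqac hqi, add_comm, ← EReal.le_sub_iff_add_le
        (Or.inl (EReal.coe_ne_bot _)) (Or.inl (EReal.coe_ne_top _)), ← EReal.coe_sub]
      refine iSup_le fun ψ => EReal.coe_le_coe_iff.2 ?_
      linarith [entropy_add_semiDual_le hac hi ψ h1 h2 hqac hqi]

end RelativeEntropy

/-- The Markov kernel with density `k` with respect to `m`. -/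
def densityKernel {X : Type*} [MeasurableSpace X] (m : Measure X) [SFinite m] (k : X → X → ℝ) :
    Kernel X X :=
  (Kernel.const X m).withDensity fun x y => ENNReal.ofReal (k x y)

section DensityKernel

variable {X : Type*} [MeasurableSpace X] {m : Measure X} [SFinite m] {k : X → X → ℝ}

lemma densityKernel_apply (hk : Measurable (Function.uncurry k)) (x : X) :
    densityKernel m k x = m.withDensity fun y => ENNReal.ofReal (k x y) := by
  rw [densityKernel, Kernel.withDensity_apply _ (by exact hk.ennreal_ofReal), Kernel.const_apply]

lemma isMarkovKernel_densityKernel (hk : Measurable (Function.uncurry k))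
    (hk0 : ∀ x y, 0 ≤ k x y) (hk1 : ∀ x, ∫ y, k x y ∂m = 1) :
    IsMarkovKernel (densityKernel m k) := by
  refine ⟨fun x => ⟨?_⟩⟩
  have hint : Integrable (k x) m := by
    by_contra hc
    have := hk1 x
    rw [integral_undef hc] at this
    exact zero_ne_one this
  rw [densityKernel_apply hk, withDensity_apply _ MeasurableSet.univ, setLIntegral_univ,
    ← ofReal_integral_eq_lintegral_ofReal hint (ae_of_all _ (hk0 x)), hk1, ENNReal.ofReal_one]

lemma integral_densityKernel (hk : Measurable (Function.uncurry k)) (hk0 : ∀ x y, 0 ≤ k x y)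
    (x : X) (g : X → ℝ) : ∫ y, g y ∂(densityKernel m k x) = ∫ y, g y * k x y ∂m := by
  have hkx : Measurable (k x) := hk.comp measurable_prodMk_left
  rw [densityKernel_apply hk, integral_withDensity_eq_integral_toReal_smul
    hkx.ennreal_ofReal (ae_of_all _ fun _ => ENNReal.ofReal_lt_top)]
  refine integral_congr_ae (ae_of_all _ fun y => ?_)
  simp only [ENNReal.toReal_ofReal (hk0 x y), smul_eq_mul, mul_comm]

lemma compProd_densityKernel (hk : Measurable (Function.uncurry k))
    [IsSFiniteKernel (densityKernel m k)] :
    m ⊗ₘ densityKernel m k = (m.prod m).withDensity fun z => ENNReal.ofReal (k z.1 z.2) := by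
  have : IsSFiniteKernel ((Kernel.const X m).withDensity fun x y => ENNReal.ofReal (k x y)) :=
    ‹IsSFiniteKernel (densityKernel m k)›
  rw [densityKernel, Measure.compProd_withDensity (by exact hk.ennreal_ofReal),
    Measure.compProd_const]

end DensityKernel

theorem entropic_kantorovich_dual (n : ℕ) (hn : 0 < n)
    (V : EuclideanSpace ℝ (Fin n) → ℝ) (hV : ContDiff ℝ 2 V) (hExi : Exi n V)
    (p : ℝ → EuclideanSpace ℝ (Fin n) → EuclideanSpace ℝ (Fin n) → ℝ)
    (hKol : IsKolmogorov n V (mV n V) p)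
    (μ0 μ1 : Measure (EuclideanSpace ℝ (Fin n)))
    (hμ0 : IsProbabilityMeasure μ0) (hμ1 : IsProbabilityMeasure μ1)
    (hReg2 : Reg2 n (mV n V) (p 1) μ0 μ1) :
    entCost (R01 n (mV n V) (p 1)) μ0 μ1 =
      relEnt μ0 (mV n V) +
        sSup { s : EReal | ∃ ψ : EuclideanSpace ℝ (Fin n) → ℝ, Continuous ψ ∧
          (∃ C : ℝ, ∀ x, |ψ x| ≤ C) ∧
          s = (((∫ y, ψ y ∂μ1) -
            ∫ x, Real.log (∫ y, Real.exp (ψ y) * p 1 x y ∂(mV n V)) ∂μ0 : ℝ) : EReal) } := by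
  have hm : SigmaFinite (mV n V) := SigmaFinite.withDensity_ofReal _
  have hk := hKol.meas 1
  have hk0 := hKol.nonneg 1
  have hκ := isMarkovKernel_densityKernel hk hk0 (hKol.mass 1 one_pos)
  have hR : mV n V ⊗ₘ densityKernel (mV n V) (p 1) = R01 n (mV n V) (p 1) :=
    compProd_densityKernel hk
  have hσ : SigmaFinite (mV n V ⊗ₘ densityKernel (mV n V) (p 1)) := by
    rw [hR]
    exact SigmaFinite.withDensity_ofReal _
  rw [← hR, entCost_compProd_eq hReg2.2.1, iSup]
  congr 2
  ext s
  constructor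
  · rintro ⟨ψ, rfl⟩
    refine ⟨ψ, ψ.continuous, ⟨‖ψ‖, ψ.norm_coe_le_norm⟩, ?_⟩
    simp only [semiDual, logPartition, integral_densityKernel hk hk0]
  · rintro ⟨ψ, hψ, ⟨C, hC⟩, rfl⟩
    refine ⟨BoundedContinuousFunction.ofNormedAddCommGroup ψ hψ C hC, ?_⟩
    simp only [semiDual, logPartition, integral_densityKernel hk hk0,
      BoundedContinuousFunction.coe_ofNormedAddCommGroup]
end
end

section
/- Dimensional contraction in entropic cost for the heat semigroup: fix ε > 0 and let (T_t) be the heat semigroup on ℝⁿ (generator Δ/2, reversing measure m = Leb). Then for all s, t ≥ 0 and all probability densities f, g with respect to Lebesgue measure: A^ε(T_t f·Leb, T_s g·Leb) ≤ A^ε(f·Leb, g·Leb) + (n/2)(√t − √s)² + ε[ H(T_t f·Leb | Leb) − H(f·Leb | Leb) ]. -/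
open MeasureTheory Real Filter Set
open scoped ENNReal Topology

noncomputable section

/-- The heat kernel on ℝⁿ for the generator `Δ/2`. -/
def heatKer (n : ℕ) (t : ℝ) (x y : EuclideanSpace ℝ (Fin n)) : ℝ :=
  (2 * π * t) ^ (-(n : ℝ) / 2) * Real.exp (-‖x - y‖ ^ 2 / (2 * t))

/-- The heat semigroup on ℝⁿ with generator `Δ/2`, reversible with respect to `Leb`. -/
def heatT (n : ℕ) (t : ℝ) (f : EuclideanSpace ℝ (Fin n) → ℝ)
    (x : EuclideanSpace ℝ (Fin n)) : ℝ :=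
  if t = 0 then f x else ∫ y, f y * heatKer n t x y

/-- The reference joint measure `R^ε₀₁(dx dy) = dx · p_ε(x,y) dy` for the heat semigroup. -/
def heatR01 (n : ℕ) (eps : ℝ) :
    Measure (EuclideanSpace ℝ (Fin n) × EuclideanSpace ℝ (Fin n)) :=
  ((volume : Measure (EuclideanSpace ℝ (Fin n))).prod volume).withDensity
    fun z => ENNReal.ofReal (heatKer n eps z.1 z.2)

/-- The rescaled entropic cost `A^ε(μ0,μ1) = ε·inf{H(π|R^ε₀₁)}` for the heat semigroup. -/
def heatA (n : ℕ) (eps : ℝ) (μ0 μ1 : Measure (EuclideanSpace ℝ (Fin n))) : EReal :=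
  ((eps : ℝ) : EReal) * entCost (heatR01 n eps) μ0 μ1

/-- A probability measure with finite relative entropy with respect to `Leb` and finite
second moment. -/
def NiceMarginal (n : ℕ) (μ : Measure (EuclideanSpace ℝ (Fin n))) : Prop :=
  relEnt μ (volume : Measure (EuclideanSpace ℝ (Fin n))) ≠ ⊤ ∧
    Integrable (fun x : EuclideanSpace ℝ (Fin n) => ‖x‖ ^ 2) μ

theorem ae_withDensity_ne_zero_ne_top {α : Type*} [MeasurableSpace α] {μ : Measure α}
    {F : α → ℝ≥0∞} (hF : Measurable F) [IsFiniteMeasure (μ.withDensity F)] :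
    ∀ᵐ x ∂μ.withDensity F, F x ≠ 0 ∧ F x ≠ ∞ := by
  have h : ∫⁻ x, F x ∂μ ≠ ∞ := by
    rw [← setLIntegral_univ, ← withDensity_apply _ MeasurableSet.univ]
    exact measure_ne_top _ _
  rw [ae_withDensity_iff hF]
  filter_upwards [ae_lt_top hF h] with x hx h0 using ⟨h0, hx.ne⟩

theorem lintegral_prod_withDensity_sub {V Z : Type*} [MeasurableSpace V] [AddCommGroup V]
    [MeasurableAdd₂ V] [MeasurableNeg V] [MeasurableSpace Z] (μ : Measure V) [SFinite μ]
    [μ.IsAddRightInvariant] (γ : Measure Z) [SFinite γ] {ρ : V → ℝ≥0∞} (hρ : Measurable ρ)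
    {T : Z → V} (hT : Measurable T) {h : V × Z → ℝ≥0∞} (hh : Measurable h) :
    ∫⁻ p, h p ∂(μ.withDensity ρ).prod γ =
      ∫⁻ w, ∫⁻ z, ρ (w - T z) * h (w - T z, z) ∂γ ∂μ := by
  have hm : Measurable fun q : V × Z => q.1 - T q.2 := by
    simp only [sub_eq_add_neg]; fun_prop
  have hswap := lintegral_lintegral_swap (μ := μ) (ν := γ)
    (f := fun w z => ρ (w - T z) * h (w - T z, z))
    ((hρ.comp hm).mul (hh.comp (hm.prodMk measurable_snd))).aemeasurable
  rw [lintegral_prod_symm _ hh.aemeasurable, hswap]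
  refine lintegral_congr fun z => ?_
  rw [lintegral_withDensity_eq_lintegral_mul _ hρ (by fun_prop),
    ← lintegral_add_right_eq_self _ (-T z)]
  simp [sub_eq_add_neg]

theorem map_add_prod_withDensity {V Z : Type*} [MeasurableSpace V] [AddCommGroup V]
    [MeasurableAdd₂ V] [MeasurableNeg V] [MeasurableSpace Z] (μ : Measure V) [SFinite μ]
    [μ.IsAddRightInvariant] (γ : Measure Z) [SFinite γ] {ρ : V → ℝ≥0∞} (hρ : Measurable ρ)
    {T : Z → V} (hT : Measurable T) :
    ((μ.withDensity ρ).prod γ).map (fun p => p.1 + T p.2) =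
      μ.withDensity fun w => ∫⁻ z, ρ (w - T z) ∂γ := by
  have hm : Measurable fun q : V × Z => q.1 - T q.2 := by
    simp only [sub_eq_add_neg]; fun_prop
  have hm2 : Measurable fun q : V × Z => ρ (q.1 - T q.2) := hρ.comp hm
  refine Measure.ext_of_lintegral _ fun h hh => ?_
  rw [lintegral_map hh (by fun_prop), lintegral_prod_withDensity_sub μ γ hρ hT (by fun_prop),
    lintegral_withDensity_eq_lintegral_mul _ (Measurable.lintegral_prod_right' hm2) hh]
  refine lintegral_congr fun w => ?_
  simp only [sub_add_cancel, Pi.mul_apply]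
  exact lintegral_mul_const _ (hm2.comp measurable_prodMk_left)

/-- Averaging translates along a common noise does not increase the conditional relative entropy
of the second coordinate given the first. -/
theorem integral_log_averaged_density_le {V W Z : Type*} [MeasurableSpace V] [AddCommGroup V]
    [MeasurableAdd₂ V] [MeasurableNeg V] [MeasurableSpace W] [AddCommGroup W]
    [MeasurableAdd₂ (V × W)] [MeasurableNeg (V × W)] [MeasurableSpace Z] (μ : Measure V) [SFinite μ]
    [μ.IsAddRightInvariant] (ν : Measure (V × W)) [SFinite ν]
    [ν.IsAddRightInvariant] (γ : Measure Z) [IsProbabilityMeasure γ]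
    {ρ : V × W → ℝ≥0∞} (hρ : Measurable ρ) {F : V → ℝ≥0∞} (hF : Measurable F)
    {T : Z → V × W} (hT : Measurable T)
    [IsProbabilityMeasure (ν.withDensity ρ)]
    (hfst : (ν.withDensity ρ).map Prod.fst = μ.withDensity F)
    {ρ' : V × W → ℝ≥0∞} (hρ' : ρ' = fun w => ∫⁻ z, ρ (w - T z) ∂γ)
    {F' : V → ℝ≥0∞} (hF' : F' = fun x => ∫⁻ z, F (x - (T z).1) ∂γ)
    (hlρ : Integrable (fun w => Real.log (ρ w).toReal) (ν.withDensity ρ))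
    (hlF : Integrable (fun x => Real.log (F x).toReal) (μ.withDensity F))
    (hlF' : Integrable (fun x => Real.log (F' x).toReal) (μ.withDensity F'))
    {G : V × W → ℝ} (hGm : Measurable G) (hG : Integrable (fun w => Real.exp (G w)) ν)
    (hG' : Integrable G (ν.withDensity ρ')) :
    Integrable (fun w => Real.log (ρ' w).toReal) (ν.withDensity ρ') ∧
      ∫ w, Real.log (ρ' w).toReal ∂ν.withDensity ρ' ≤
        ∫ w, Real.log (ρ w).toReal ∂ν.withDensity ρ
          - ∫ x, Real.log (F x).toReal ∂μ.withDensity F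
          + ∫ x, Real.log (F' x).toReal ∂μ.withDensity F' := by
  have hsub : Measurable fun q : (V × W) × Z => q.1 - T q.2 := by
    simp only [sub_eq_add_neg]; fun_prop
  have hsub1 : Measurable fun q : V × Z => q.1 - (T q.2).1 := by
    simp only [sub_eq_add_neg]; fun_prop
  have hρ'm : Measurable ρ' := by
    rw [hρ']; exact Measurable.lintegral_prod_right' (hρ.comp hsub)
  have hF'm : Measurable F' := by
    rw [hF']; exact Measurable.lintegral_prod_right' (hF.comp hsub1)
  have hT1 : Measurable fun z => (T z).1 := by fun_prop
  set P := (ν.withDensity ρ).prod γ with hP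
  have hadd : Measurable fun p : (V × W) × Z => p.1 + T p.2 := by fun_prop
  have mapρ' : P.map (fun p => p.1 + T p.2) = ν.withDensity ρ' := by
    rw [hρ', hP, map_add_prod_withDensity ν γ hρ hT]
  have mapρ : P.map Prod.fst = ν.withDensity ρ := by
    rw [hP, Measure.map_fst_prod, measure_univ, one_smul]
  have mapF : P.map (fun p => p.1.1) = μ.withDensity F := by
    rw [← hfst, ← mapρ, Measure.map_map (by fun_prop) (by fun_prop)]; rfl
  have : IsProbabilityMeasure (μ.withDensity F) := by
    rw [← mapF]; exact Measure.isProbabilityMeasure_map (by fun_prop)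
  have mapF' : P.map (fun p => (p.1 + T p.2).1) = μ.withDensity F' := by
    rw [hF', ← map_add_prod_withDensity μ γ hF hT1, ← hfst]
    have h := Measure.map_prod_map (ν.withDensity ρ) γ measurable_fst measurable_id
    rw [Measure.map_id] at h
    rw [h, Measure.map_map (by fun_prop) (by fun_prop)]
    rfl
  have : IsProbabilityMeasure (ν.withDensity ρ') := by
    rw [← mapρ']; exact Measure.isProbabilityMeasure_map (by fun_prop)
  have : IsProbabilityMeasure (μ.withDensity F') := by
    rw [← mapF']; exact Measure.isProbabilityMeasure_map (by fun_prop)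
  have aeρ : ∀ᵐ p ∂P, ρ p.1 ≠ 0 ∧ ρ p.1 ≠ ∞ :=
    ae_of_ae_map (by fun_prop) (mapρ ▸ ae_withDensity_ne_zero_ne_top hρ)
  have aeF : ∀ᵐ p ∂P, F p.1.1 ≠ 0 ∧ F p.1.1 ≠ ∞ :=
    ae_of_ae_map (f := fun p : (V × W) × Z => p.1.1) (by fun_prop)
      (mapF ▸ ae_withDensity_ne_zero_ne_top hF)
  have aeρ' : ∀ᵐ p ∂P, ρ' (p.1 + T p.2) ≠ 0 ∧ ρ' (p.1 + T p.2) ≠ ∞ :=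
    ae_of_ae_map (f := fun p : (V × W) × Z => p.1 + T p.2) (by fun_prop)
      (mapρ' ▸ ae_withDensity_ne_zero_ne_top hρ'm)
  have aeF' : ∀ᵐ p ∂P, F' (p.1 + T p.2).1 ≠ 0 ∧ F' (p.1 + T p.2).1 ≠ ∞ :=
    ae_of_ae_map (f := fun p : (V × W) × Z => (p.1 + T p.2).1) (by fun_prop)
      (mapF' ▸ ae_withDensity_ne_zero_ne_top hF'm)
  have iρ : Integrable (fun p : (V × W) × Z => Real.log (ρ p.1).toReal) P := by
    rw [← mapρ] at hlρ; exact hlρ.comp_measurable (by fun_prop)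
  have iF : Integrable (fun p : (V × W) × Z => Real.log (F p.1.1).toReal) P := by
    rw [← mapF] at hlF; exact hlF.comp_measurable (by fun_prop)
  have iF' : Integrable (fun p : (V × W) × Z => Real.log (F' (p.1 + T p.2).1).toReal) P := by
    rw [← mapF'] at hlF'; exact hlF'.comp_measurable (by fun_prop)
  have iG : Integrable (fun p : (V × W) × Z => G (p.1 + T p.2)) P := by
    rw [← mapρ'] at hG'; exact hG'.comp_measurable (by fun_prop)
  set u : (V × W) × Z → ℝ≥0∞ := fun p =>
    (ρ p.1)⁻¹ * (F p.1.1 * (ρ' (p.1 + T p.2) * (F' (p.1 + T p.2).1)⁻¹)) with hu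
  have hum : Measurable u := by fun_prop
  have hu1 : ∫⁻ p, u p ∂P ≤ 1 := by
    rw [hP, lintegral_prod_withDensity_sub ν γ hρ hT hum]
    calc _ ≤ ∫⁻ w, ρ' w ∂ν := by
          refine lintegral_mono fun w => ?_
          calc _ ≤ ∫⁻ z, F (w.1 - (T z).1) * (ρ' w * (F' w.1)⁻¹) ∂γ := by
                refine lintegral_mono fun z => ?_
                simp only [hu, sub_add_cancel, ← mul_assoc, Prod.fst_sub]
                gcongr
                exact mul_le_of_le_one_left (zero_le) (ENNReal.mul_inv_le_one _)
            _ = F' w.1 * (ρ' w * (F' w.1)⁻¹) := by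
                rw [lintegral_mul_const _ (by exact hF.comp (hsub1.comp measurable_prodMk_left)),
                  hF']
            _ = ρ' w * (F' w.1 * (F' w.1)⁻¹) := by ring
            _ ≤ ρ' w := mul_le_of_le_one_right (zero_le) (ENNReal.mul_inv_le_one _)
      _ = 1 := by
          rw [← setLIntegral_univ, ← withDensity_apply _ MeasurableSet.univ, measure_univ]
  have hut : ∫⁻ p, u p ∂P ≠ ∞ := (hu1.trans_lt ENNReal.one_lt_top).ne
  have iu : Integrable (fun p => (u p).toReal) P := integrable_toReal_of_lintegral_ne_top
    hum.aemeasurable hut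
  have intu : ∫ p, (u p).toReal ∂P ≤ 1 := by
    rw [integral_toReal hum.aemeasurable (ae_lt_top hum hut)]
    exact ENNReal.toReal_le_of_le_ofReal zero_le_one (by simpa using hu1)
  set v : V × W → ℝ≥0∞ := fun w => ENNReal.ofReal (Real.exp (G w)) * (ρ' w)⁻¹ with hv
  have hvm : Measurable v := by fun_prop
  have hvt : ∫⁻ w, v w ∂ν.withDensity ρ' ≠ ∞ := by
    rw [lintegral_withDensity_eq_lintegral_mul _ hρ'm hvm]
    refine (lt_of_le_of_lt (lintegral_mono fun w => ?_) hG.lintegral_lt_top).ne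
    calc _ = ENNReal.ofReal (Real.exp (G w)) * (ρ' w * (ρ' w)⁻¹) := by
          simp only [Pi.mul_apply, hv]; ring
      _ ≤ _ := mul_le_of_le_one_right (zero_le) (ENNReal.mul_inv_le_one _)
  have iv : Integrable (fun p : (V × W) × Z => (v (p.1 + T p.2)).toReal) P := by
    have := integrable_toReal_of_lintegral_ne_top hvm.aemeasurable hvt
    rw [← mapρ'] at this
    exact this.comp_measurable (by fun_prop)
  have upper : ∀ᵐ p ∂P, Real.log (ρ' (p.1 + T p.2)).toReal ≤
      Real.log (ρ p.1).toReal - Real.log (F p.1.1).toReal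
        + Real.log (F' (p.1 + T p.2).1).toReal + ((u p).toReal - 1) := by
    filter_upwards [aeρ, aeF, aeρ', aeF'] with p h1 h2 h3 h4
    have p1 := ENNReal.toReal_pos h1.1 h1.2
    have p2 := ENNReal.toReal_pos h2.1 h2.2
    have p3 := ENNReal.toReal_pos h3.1 h3.2
    have p4 := ENNReal.toReal_pos h4.1 h4.2
    have e : (u p).toReal = (ρ p.1).toReal⁻¹ * ((F p.1.1).toReal *
        ((ρ' (p.1 + T p.2)).toReal * (F' (p.1 + T p.2).1).toReal⁻¹)) := by
      simp [hu, ENNReal.toReal_mul]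
    have hl := Real.log_le_sub_one_of_pos (x := (u p).toReal) (by rw [e]; positivity)
    rw [e, Real.log_mul (by positivity) (by positivity), Real.log_mul (by positivity)
      (by positivity), Real.log_mul (by positivity) (by positivity), Real.log_inv,
      Real.log_inv, ← e] at hl
    linarith
  have lower : ∀ᵐ p ∂P, G (p.1 + T p.2) - ((v (p.1 + T p.2)).toReal - 1) ≤
      Real.log (ρ' (p.1 + T p.2)).toReal := by
    filter_upwards [aeρ'] with p h3
    have p3 := ENNReal.toReal_pos h3.1 h3.2
    have e : (v (p.1 + T p.2)).toReal =
        Real.exp (G (p.1 + T p.2)) * (ρ' (p.1 + T p.2)).toReal⁻¹ := by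
      simp [hv, ENNReal.toReal_mul, ENNReal.toReal_ofReal (Real.exp_nonneg _)]
    have hl := Real.log_le_sub_one_of_pos (x := (v (p.1 + T p.2)).toReal) (by rw [e]; positivity)
    rw [e, Real.log_mul (by positivity) (by positivity), Real.log_inv, Real.log_exp, ← e] at hl
    linarith
  have iL := (iρ.sub iF).add iF'
  have iU := iL.add (iu.sub (integrable_const (1 : ℝ)))
  have iρ' : Integrable (fun p : (V × W) × Z => Real.log (ρ' (p.1 + T p.2)).toReal) P :=
    integrable_of_le_of_le
      ((hρ'm.comp hadd).ennreal_toReal.log.aestronglyMeasurable) lower upper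
      (iG.sub (iv.sub (integrable_const (1 : ℝ)))) iU
  have mlρ := hρ.ennreal_toReal.log
  have mlF := hF.ennreal_toReal.log
  have mlρ' := hρ'm.ennreal_toReal.log
  have mlF' := hF'm.ennreal_toReal.log
  refine ⟨?_, ?_⟩
  · rw [← mapρ', integrable_map_measure mlρ'.aestronglyMeasurable (by fun_prop)]
    exact iρ'
  · rw [← mapρ', ← mapρ, ← mapF, ← mapF',
      integral_map (by fun_prop) mlρ'.aestronglyMeasurable,
      integral_map (by fun_prop) mlρ.aestronglyMeasurable,
      integral_map (by fun_prop) mlF.aestronglyMeasurable,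
      integral_map (by fun_prop) mlF'.aestronglyMeasurable]
    have h1 := integral_mono_ae iρ' iU upper
    rw [integral_add' iL (iu.sub (integrable_const (1 : ℝ))), integral_add' (iρ.sub iF) iF',
      integral_sub' iρ iF, integral_sub' iu (integrable_const (1 : ℝ))] at h1
    simp only [integral_const, probReal_univ, one_smul] at h1
    linarith

theorem continuous_heatKer (n : ℕ) (t : ℝ) :
    Continuous fun z : EuclideanSpace ℝ (Fin n) × EuclideanSpace ℝ (Fin n) =>
      heatKer n t z.1 z.2 := by
  unfold heatKer; fun_prop

theorem heatKer_pos (n : ℕ) {t : ℝ} (ht : 0 < t) (x y : EuclideanSpace ℝ (Fin n)) :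
    0 < heatKer n t x y := by
  unfold heatKer; positivity

theorem heatKer_one_zero (n : ℕ) (z : EuclideanSpace ℝ (Fin n)) :
    heatKer n 1 0 z = (2 * π) ^ (-(n : ℝ) / 2) * Real.exp (-(1 / 2) * ‖z‖ ^ 2) := by
  simp only [heatKer, mul_one, zero_sub, norm_neg]
  congr 2; ring

theorem integral_exp_neg_half_norm_sq (n : ℕ) :
    ∫ z : EuclideanSpace ℝ (Fin n), Real.exp (-(1 / 2) * ‖z‖ ^ 2) = (2 * π) ^ ((n : ℝ) / 2) := by
  rw [GaussianFourier.integral_rexp_neg_mul_sq_norm (by norm_num), finrank_euclideanSpace_fin]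
  congr 1; ring

theorem integrable_exp_neg_half_norm_sq (n : ℕ) :
    Integrable fun z : EuclideanSpace ℝ (Fin n) => Real.exp (-(1 / 2) * ‖z‖ ^ 2) := by
  refine Integrable.of_integral_ne_zero ?_
  rw [integral_exp_neg_half_norm_sq]
  positivity

theorem integral_norm_sq_mul_exp_neg_half_norm_sq (n : ℕ) (hn : 0 < n) :
    ∫ z : EuclideanSpace ℝ (Fin n), ‖z‖ ^ 2 * Real.exp (-(1 / 2) * ‖z‖ ^ 2) =
      n * (2 * π) ^ ((n : ℝ) / 2) := by
  have : Nonempty (Fin n) := ⟨⟨0, hn⟩⟩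
  have hn' : (0 : ℝ) < n := by exact_mod_cast hn
  rw [← integral_exp_neg_half_norm_sq,
    integral_fun_norm_addHaar volume (fun r => r ^ 2 * Real.exp (-(1 / 2) * r ^ 2)),
    integral_fun_norm_addHaar volume (fun r => Real.exp (-(1 / 2) * r ^ 2))]
  have h2 : ∫ y in Ioi (0 : ℝ), y ^ (n - 1) • (y ^ 2 * Real.exp (-(1 / 2) * y ^ 2)) =
      ∫ y in Ioi (0 : ℝ), y ^ ((n : ℝ) + 1) * Real.exp (-(1 / 2) * y ^ (2 : ℝ)) := by
    refine setIntegral_congr_fun measurableSet_Ioi fun y _ => ?_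
    have e : (n : ℝ) + 1 = ((n + 1 : ℕ) : ℝ) := by push_cast; ring
    simp only [smul_eq_mul, e, Real.rpow_natCast, Real.rpow_two]
    rw [← mul_assoc, ← pow_add]
    congr 2; omega
  have h0 : ∫ y in Ioi (0 : ℝ), y ^ (n - 1) • Real.exp (-(1 / 2) * y ^ 2) =
      ∫ y in Ioi (0 : ℝ), y ^ ((n : ℝ) - 1) * Real.exp (-(1 / 2) * y ^ (2 : ℝ)) := by
    refine setIntegral_congr_fun measurableSet_Ioi fun y _ => ?_
    have e : (n : ℝ) - 1 = ((n - 1 : ℕ) : ℝ) := by rw [Nat.cast_sub hn]; simp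
    simp only [smul_eq_mul, e, Real.rpow_natCast, Real.rpow_two]
  rw [finrank_euclideanSpace_fin, h2, h0,
    integral_rpow_mul_exp_neg_mul_rpow (by norm_num) (by linarith) (by norm_num),
    integral_rpow_mul_exp_neg_mul_rpow (by norm_num) (by linarith) (by norm_num)]
  have e1 : ((n : ℝ) + 1 + 1) / 2 = n / 2 + 1 := by ring
  have e2 : ((n : ℝ) - 1 + 1) / 2 = n / 2 := by ring
  have e3 : -((n : ℝ) + 1 + 1) / 2 = -(n : ℝ) / 2 - 1 := by ring
  have e4 : -((n : ℝ) - 1 + 1) / 2 = -(n : ℝ) / 2 := by ring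
  rw [e1, e2, e3, e4, Real.Gamma_add_one (by positivity), Real.rpow_sub_one (by norm_num)]
  simp only [nsmul_eq_mul, smul_eq_mul]
  ring

/-- The standard Gaussian measure on `ℝⁿ`, with density the heat kernel at time one. -/
def heatGauss (n : ℕ) : Measure (EuclideanSpace ℝ (Fin n)) :=
  volume.withDensity fun z => ENNReal.ofReal (heatKer n 1 0 z)

theorem measurable_ofReal_heatKer_one_zero (n : ℕ) :
    Measurable fun z : EuclideanSpace ℝ (Fin n) => ENNReal.ofReal (heatKer n 1 0 z) := by
  have := (continuous_heatKer n 1).comp (Continuous.prodMk_right (0 : EuclideanSpace ℝ (Fin n)))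
  exact this.measurable.ennreal_ofReal

theorem integral_heatGauss (n : ℕ) (h : EuclideanSpace ℝ (Fin n) → ℝ) :
    ∫ z, h z ∂heatGauss n =
      (2 * π) ^ (-(n : ℝ) / 2) * ∫ z, h z * Real.exp (-(1 / 2) * ‖z‖ ^ 2) := by
  rw [heatGauss, integral_withDensity_eq_integral_toReal_smul
    (measurable_ofReal_heatKer_one_zero n) (by simp), ← integral_const_mul]
  refine integral_congr_ae (ae_of_all _ fun z => ?_)
  simp only [smul_eq_mul]
  rw [ENNReal.toReal_ofReal (heatKer_pos n one_pos 0 z).le, heatKer_one_zero]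
  ring

theorem two_pi_rpow_mul_rpow (n : ℕ) :
    (2 * π) ^ (-(n : ℝ) / 2) * (2 * π) ^ ((n : ℝ) / 2) = 1 := by
  rw [← Real.rpow_add (by positivity)]
  ring_nf
  simp

theorem isProbabilityMeasure_heatGauss (n : ℕ) : IsProbabilityMeasure (heatGauss n) := by
  constructor
  rw [heatGauss, withDensity_apply _ MeasurableSet.univ, setLIntegral_univ,
    ← ofReal_integral_eq_lintegral_ofReal]
  · simp only [heatKer_one_zero]
    rw [integral_const_mul, integral_exp_neg_half_norm_sq, two_pi_rpow_mul_rpow]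
    simp
  · exact ((integrable_exp_neg_half_norm_sq n).const_mul _).congr
      (ae_of_all _ fun z => (heatKer_one_zero n z).symm)
  · exact ae_of_all _ fun z => (heatKer_pos n one_pos 0 z).le

theorem integral_norm_sq_heatGauss (n : ℕ) (hn : 0 < n) :
    ∫ z, ‖z‖ ^ 2 ∂heatGauss n = n := by
  rw [integral_heatGauss, integral_norm_sq_mul_exp_neg_half_norm_sq n hn, mul_left_comm,
    two_pi_rpow_mul_rpow, mul_one]

theorem integrable_norm_sq_heatGauss (n : ℕ) (hn : 0 < n) :
    Integrable (fun z => ‖z‖ ^ 2) (heatGauss n) := by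
  refine Integrable.of_integral_ne_zero ?_
  rw [integral_norm_sq_heatGauss n hn]
  exact_mod_cast hn.ne'

theorem integral_inner_heatGauss (n : ℕ) (w : EuclideanSpace ℝ (Fin n)) :
    ∫ z, inner ℝ w z ∂heatGauss n = 0 := by
  rw [integral_heatGauss]
  have h := integral_neg_eq_self (μ := volume)
    (fun z : EuclideanSpace ℝ (Fin n) => inner ℝ w z * Real.exp (-(1 / 2) * ‖z‖ ^ 2))
  simp only [inner_neg_right, norm_neg, neg_mul, integral_neg] at h
  simp only [neg_mul]
  rw [show ∫ z : EuclideanSpace ℝ (Fin n), inner ℝ w z * Real.exp (-(1 / 2 * ‖z‖ ^ 2)) = 0 by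
    linarith, mul_zero]

/-- Adding the same Gaussian noise with two different intensities changes the mean squared
distance by `n (a - b)²`. -/
theorem integral_norm_sub_sq_add_heatGauss (n : ℕ) (hn : 0 < n)
    (pl : Measure (EuclideanSpace ℝ (Fin n) × EuclideanSpace ℝ (Fin n))) [IsProbabilityMeasure pl]
    (hpl : Integrable (fun w => ‖w.1 - w.2‖ ^ 2) pl) (a b : ℝ) :
    ∫ p, ‖(p.1.1 + a • p.2) - (p.1.2 + b • p.2)‖ ^ 2 ∂pl.prod (heatGauss n) =
      ∫ w, ‖w.1 - w.2‖ ^ 2 ∂pl + n * (a - b) ^ 2 := by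
  have := isProbabilityMeasure_heatGauss n
  have i1 : Integrable (fun p => ‖p.1.1 - p.1.2‖ ^ 2) (pl.prod (heatGauss n)) := hpl.comp_fst _
  have i2 : Integrable (fun p => ‖p.2‖ ^ 2) (pl.prod (heatGauss n)) :=
    (integrable_norm_sq_heatGauss n hn).comp_snd _
  have i3 : Integrable (fun p => inner ℝ (p.1.1 - p.1.2) p.2) (pl.prod (heatGauss n)) := by
    refine (i1.add i2).mono' (by fun_prop) (ae_of_all _ fun p => ?_)
    have h1 := norm_inner_le_norm (𝕜 := ℝ) (p.1.1 - p.1.2) p.2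
    simp only [Pi.add_apply]
    nlinarith [sq_nonneg (‖p.1.1 - p.1.2‖ - ‖p.2‖), sq_nonneg (‖p.1.1 - p.1.2‖),
      sq_nonneg (‖p.2‖)]
  have e3 : ∫ p, inner ℝ (p.1.1 - p.1.2) p.2 ∂pl.prod (heatGauss n) = 0 := by
    rw [integral_prod _ i3]
    simp [integral_inner_heatGauss]
  have e1 : ∫ p, ‖p.1.1 - p.1.2‖ ^ 2 ∂pl.prod (heatGauss n) = ∫ w, ‖w.1 - w.2‖ ^ 2 ∂pl := by
    rw [integral_prod _ i1]; simp
  have e2 : ∫ p, ‖p.2‖ ^ 2 ∂pl.prod (heatGauss n) = n := by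
    rw [integral_prod _ i2]; simp [integral_norm_sq_heatGauss n hn]
  have i12 : Integrable (fun p => ‖p.1.1 - p.1.2‖ ^ 2 + (a - b) ^ 2 * ‖p.2‖ ^ 2)
      (pl.prod (heatGauss n)) := i1.add (i2.const_mul _)
  calc _ = ∫ p, (‖p.1.1 - p.1.2‖ ^ 2 + (a - b) ^ 2 * ‖p.2‖ ^ 2
        + 2 * (a - b) * inner ℝ (p.1.1 - p.1.2) p.2) ∂pl.prod (heatGauss n) := by
        refine integral_congr_ae (ae_of_all _ fun p => ?_)
        have : (p.1.1 + a • p.2) - (p.1.2 + b • p.2) = (p.1.1 - p.1.2) + (a - b) • p.2 := by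
          module
        simp only [this]
        rw [norm_add_sq_real, norm_smul, mul_pow, inner_smul_right, Real.norm_eq_abs, sq_abs]
        ring
    _ = _ := by
        rw [integral_add i12 (i3.const_mul _),
          integral_add i1 (i2.const_mul _), integral_const_mul, integral_const_mul, e1, e2, e3]
        ring

theorem heatT_eq_integral (n : ℕ) {t : ℝ} (ht : 0 < t) (f : EuclideanSpace ℝ (Fin n) → ℝ)
    (x : EuclideanSpace ℝ (Fin n)) :
    heatT n t f x = ∫ z, f (x - √t • z) * heatKer n 1 0 z := by
  have h1 := integral_sub_left_eq_self (fun y => f y * heatKer n t x y) volume x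
  have h2 := Measure.integral_comp_smul volume
    (fun y => f (x - y) * heatKer n t x (x - y)) (√t)
  have hst : 0 < √t := Real.sqrt_pos.2 ht
  rw [finrank_euclideanSpace_fin, h1, abs_of_pos (by positivity), smul_eq_mul,
    eq_inv_mul_iff_mul_eq₀ (by positivity), ← integral_const_mul] at h2
  rw [heatT, if_neg ht.ne', ← h2]
  refine integral_congr_ae (ae_of_all _ fun z => ?_)
  have e : √t ^ n * (2 * π * t) ^ (-(n : ℝ) / 2) = (2 * π) ^ (-(n : ℝ) / 2) := by
    rw [Real.mul_rpow (by positivity) ht.le, Real.sqrt_eq_rpow, ← Real.rpow_natCast,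
      ← Real.rpow_mul ht.le, mul_left_comm, ← Real.rpow_add ht]
    ring_nf
    simp
  beta_reduce
  rw [heatKer_one_zero, ← e]
  simp only [heatKer, sub_sub_cancel, norm_smul, Real.norm_eq_abs, mul_pow, sq_abs,
    Real.sq_sqrt ht.le]
  have e2 : -(t * ‖z‖ ^ 2) / (2 * t) = -(1 / 2) * ‖z‖ ^ 2 := by field_simp
  rw [e2]
  ring

theorem ofReal_heatT (n : ℕ) {t : ℝ} (ht : 0 ≤ t) {f : EuclideanSpace ℝ (Fin n) → ℝ}
    (hf : Measurable f) (hf0 : ∀ x, 0 ≤ f x) (hfi : Integrable f)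
    (x : EuclideanSpace ℝ (Fin n)) :
    ENNReal.ofReal (heatT n t f x) = ∫⁻ z, ENNReal.ofReal (f (x - √t • z)) ∂heatGauss n := by
  have := isProbabilityMeasure_heatGauss n
  rcases ht.eq_or_lt with rfl | ht
  · simp [heatT]
  have hm : Measurable fun z : EuclideanSpace ℝ (Fin n) => heatKer n 1 0 z :=
    ((continuous_heatKer n 1).comp (Continuous.prodMk_right _)).measurable
  rw [heatT_eq_integral n ht, heatGauss, lintegral_withDensity_eq_lintegral_mul _
    (measurable_ofReal_heatKer_one_zero n) (by fun_prop), ofReal_integral_eq_lintegral_ofReal]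
  · refine lintegral_congr fun z => ?_
    rw [ENNReal.ofReal_mul (hf0 _), mul_comm, Pi.mul_apply]
  · refine ((hfi.comp_sub_left x).comp_smul (Real.sqrt_pos.2 ht).ne').mul_bdd
      (c := (2 * π) ^ (-(n : ℝ) / 2)) hm.aestronglyMeasurable (ae_of_all _ fun z => ?_)
    rw [Real.norm_of_nonneg (heatKer_pos n one_pos 0 z).le, heatKer_one_zero]
    refine mul_le_of_le_one_right (by positivity) (Real.exp_le_one_iff.2 ?_)
    nlinarith [sq_nonneg ‖z‖]
  · exact ae_of_all _ fun z => mul_nonneg (hf0 _) (heatKer_pos n one_pos 0 z).le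

theorem relEnt_ne_top_iff {α : Type*} [MeasurableSpace α] {q r : Measure α} :
    relEnt q r ≠ ⊤ ↔
      q ≪ r ∧ Integrable (fun x => Real.log ((q.rnDeriv r x).toReal)) q := by
  unfold relEnt
  split_ifs with h <;> simp [h]

theorem relEnt_withDensity_of_integrable {α : Type*} [MeasurableSpace α] {μ : Measure α}
    [SigmaFinite μ] {F : α → ℝ≥0∞} (hF : Measurable F)
    (h : Integrable (fun x => Real.log (F x).toReal) (μ.withDensity F)) :
    relEnt (μ.withDensity F) μ =
      ((∫ x, Real.log (F x).toReal ∂μ.withDensity F : ℝ) : EReal) := by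
  have hac := withDensity_absolutelyContinuous μ F
  have hae : (fun x => Real.log ((μ.withDensity F).rnDeriv μ x).toReal)
      =ᵐ[μ.withDensity F] fun x => Real.log (F x).toReal := by
    filter_upwards [hac.ae_le (Measure.rnDeriv_withDensity μ hF)] with x hx
    rw [hx]
  rw [relEnt, if_pos ⟨hac, h.congr hae.symm⟩, integral_congr_ae hae]

theorem integrable_log_of_relEnt_ne_top {α : Type*} [MeasurableSpace α] {μ : Measure α}
    [SigmaFinite μ] {F : α → ℝ≥0∞} (hF : Measurable F) (h : relEnt (μ.withDensity F) μ ≠ ⊤) :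
    Integrable (fun x => Real.log (F x).toReal) (μ.withDensity F) := by
  have hac := withDensity_absolutelyContinuous μ F
  refine (relEnt_ne_top_iff.1 h).2.congr ?_
  filter_upwards [hac.ae_le (Measure.rnDeriv_withDensity μ hF)] with x hx
  rw [hx]

theorem relEnt_withDensity_withDensity {α : Type*} [MeasurableSpace α] {ν : Measure α}
    [SigmaFinite ν] {ρ : α → ℝ≥0∞} (hρ : Measurable ρ) [IsFiniteMeasure (ν.withDensity ρ)]
    {κ : α → ℝ} (hκ : Measurable κ) (hκ0 : ∀ x, 0 < κ x)
    (h1 : Integrable (fun x => Real.log (ρ x).toReal) (ν.withDensity ρ))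
    (h2 : Integrable (fun x => Real.log (κ x)) (ν.withDensity ρ)) :
    relEnt (ν.withDensity ρ) (ν.withDensity fun x => ENNReal.ofReal (κ x)) =
      ((∫ x, Real.log (ρ x).toReal ∂ν.withDensity ρ
        - ∫ x, Real.log (κ x) ∂ν.withDensity ρ : ℝ) : EReal) := by
  have hφ : Measurable fun x => ρ x * (ENNReal.ofReal (κ x))⁻¹ := by fun_prop
  have e : (ν.withDensity fun x => ENNReal.ofReal (κ x)).withDensity
      (fun x => ρ x * (ENNReal.ofReal (κ x))⁻¹) = ν.withDensity ρ := by
    rw [← withDensity_mul _ (by fun_prop) hφ]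
    congr 1
    ext x
    rw [Pi.mul_apply, mul_left_comm, ENNReal.mul_inv_cancel (by simpa using hκ0 x) (by simp),
      mul_one]
  have hae : (fun x => Real.log (ρ x).toReal - Real.log (κ x)) =ᵐ[ν.withDensity ρ]
      fun x => Real.log (ρ x * (ENNReal.ofReal (κ x))⁻¹).toReal := by
    filter_upwards [ae_withDensity_ne_zero_ne_top hρ] with x hx
    have := ENNReal.toReal_pos hx.1 hx.2
    rw [ENNReal.toReal_mul, ENNReal.toReal_inv, ENNReal.toReal_ofReal (hκ0 x).le,
      Real.log_mul this.ne' (inv_ne_zero (hκ0 x).ne'), Real.log_inv, sub_eq_add_neg]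
  have h := relEnt_withDensity_of_integrable (μ := ν.withDensity fun x => ENNReal.ofReal (κ x)) hφ
    (by rw [e]; exact (h1.sub h2).congr hae)
  rw [e] at h
  rw [h, ← integral_congr_ae hae, integral_sub h1 h2]

theorem exists_density_of_relEnt_ne_top {α : Type*} [MeasurableSpace α] {ν : Measure α}
    [SigmaFinite ν] {κ : α → ℝ} (hκ : Measurable κ) (hκ0 : ∀ x, 0 < κ x)
    {pl : Measure α} [IsFiniteMeasure pl] (h : Integrable (fun x => Real.log (κ x)) pl)
    (hpl : relEnt pl (ν.withDensity fun x => ENNReal.ofReal (κ x)) ≠ ⊤) :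
    ∃ ρ : α → ℝ≥0∞, Measurable ρ ∧ pl = ν.withDensity ρ ∧
      Integrable (fun x => Real.log (ρ x).toReal) pl := by
  set R := ν.withDensity fun x => ENNReal.ofReal (κ x) with hR
  obtain ⟨hac, hint⟩ := relEnt_ne_top_iff.1 hpl
  have hφ : Measurable (pl.rnDeriv R) := Measure.measurable_rnDeriv _ _
  have e := Measure.withDensity_rnDeriv_eq pl R hac
  have : IsFiniteMeasure (R.withDensity (pl.rnDeriv R)) := by rw [e]; infer_instance
  have hpos := ae_withDensity_ne_zero_ne_top (μ := R) hφ
  rw [e] at hpos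
  refine ⟨(fun x => ENNReal.ofReal (κ x)) * pl.rnDeriv R, by fun_prop, ?_, ?_⟩
  · rw [withDensity_mul _ (by fun_prop) hφ, ← hR, e]
  · refine (h.add hint).congr ?_
    filter_upwards [hpos] with x hx
    have := ENNReal.toReal_pos hx.1 hx.2
    rw [Pi.mul_apply, ENNReal.toReal_mul, ENNReal.toReal_ofReal (hκ0 x).le,
      Real.log_mul (hκ0 x).ne' this.ne']
    rfl

theorem log_heatKer (n : ℕ) {t : ℝ} (ht : 0 < t) (x y : EuclideanSpace ℝ (Fin n)) :
    Real.log (heatKer n t x y) =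
      -(n : ℝ) / 2 * Real.log (2 * π * t) - ‖x - y‖ ^ 2 / (2 * t) := by
  rw [heatKer, Real.log_mul (by positivity) (by positivity), Real.log_exp,
    Real.log_rpow (by positivity), neg_div (2 * t), ← sub_eq_add_neg]

theorem integrable_norm_sub_sq_of_map {n : ℕ}
    {pl : Measure (EuclideanSpace ℝ (Fin n) × EuclideanSpace ℝ (Fin n))}
    (h1 : Integrable (fun x => ‖x‖ ^ 2) (pl.map Prod.fst))
    (h2 : Integrable (fun x => ‖x‖ ^ 2) (pl.map Prod.snd)) :
    Integrable (fun w => ‖w.1 - w.2‖ ^ 2) pl := by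
  have i1 := h1.comp_measurable measurable_fst
  have i2 := h2.comp_measurable measurable_snd
  refine ((i1.add i2).const_mul 2).mono' (by fun_prop) (ae_of_all _ fun w => ?_)
  rw [Real.norm_of_nonneg (by positivity)]
  simp only [Pi.add_apply, Function.comp_apply]
  have := norm_sub_le w.1 w.2
  nlinarith [sq_nonneg (‖w.1‖ - ‖w.2‖), norm_nonneg (w.1 - w.2), norm_nonneg w.1, norm_nonneg w.2]

theorem integrable_log_heatKer {n : ℕ} {t : ℝ} (ht : 0 < t)
    {pl : Measure (EuclideanSpace ℝ (Fin n) × EuclideanSpace ℝ (Fin n))} [IsFiniteMeasure pl]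
    (h : Integrable (fun w => ‖w.1 - w.2‖ ^ 2) pl) :
    Integrable (fun w => Real.log (heatKer n t w.1 w.2)) pl := by
  simp only [log_heatKer n ht]
  exact (integrable_const _).sub (h.div_const _)

theorem integral_log_heatKer {n : ℕ} {t : ℝ} (ht : 0 < t)
    {pl : Measure (EuclideanSpace ℝ (Fin n) × EuclideanSpace ℝ (Fin n))} [IsProbabilityMeasure pl]
    (h : Integrable (fun w => ‖w.1 - w.2‖ ^ 2) pl) :
    ∫ w, Real.log (heatKer n t w.1 w.2) ∂pl =
      -(n : ℝ) / 2 * Real.log (2 * π * t) - (∫ w, ‖w.1 - w.2‖ ^ 2 ∂pl) / (2 * t) := by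
  simp only [log_heatKer n ht]
  rw [integral_sub (integrable_const _) (h.div_const _), integral_div]
  simp

/-- Adding a common Gaussian noise to a coupling of finite entropy yields a coupling of the
heat-regularised marginals whose relative entropy is controlled. -/
theorem exists_coupling_heatT_relEnt_le (n : ℕ) (hn : 0 < n) {eps : ℝ} (heps : 0 < eps)
    {s t : ℝ} (hs : 0 ≤ s) (ht : 0 ≤ t) {f g : EuclideanSpace ℝ (Fin n) → ℝ}
    (hf : Measurable f) (hf0 : ∀ x, 0 ≤ f x) (hfi : Integrable f)
    (hg : Measurable g) (hg0 : ∀ x, 0 ≤ g x) (hgi : Integrable g)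
    (hf1 : NiceMarginal n (volume.withDensity fun x => ENNReal.ofReal (f x)))
    (hg1 : NiceMarginal n (volume.withDensity fun x => ENNReal.ofReal (g x)))
    (hf2 : NiceMarginal n (volume.withDensity fun x => ENNReal.ofReal (heatT n t f x)))
    (hg2 : NiceMarginal n (volume.withDensity fun x => ENNReal.ofReal (heatT n s g x)))
    (pl : Measure (EuclideanSpace ℝ (Fin n) × EuclideanSpace ℝ (Fin n)))
    [IsProbabilityMeasure pl]
    (hfst : pl.map Prod.fst = volume.withDensity fun x => ENNReal.ofReal (f x))
    (hsnd : pl.map Prod.snd = volume.withDensity fun x => ENNReal.ofReal (g x))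
    (hpl : relEnt pl (heatR01 n eps) ≠ ⊤) :
    ∃ pl' : Measure (EuclideanSpace ℝ (Fin n) × EuclideanSpace ℝ (Fin n)),
      IsProbabilityMeasure pl' ∧
      pl'.map Prod.fst = (volume.withDensity fun x => ENNReal.ofReal (heatT n t f x)) ∧
      pl'.map Prod.snd = (volume.withDensity fun x => ENNReal.ofReal (heatT n s g x)) ∧
      relEnt pl' (heatR01 n eps) ≤ relEnt pl (heatR01 n eps) +
        (((n : ℝ) * (√t - √s) ^ 2 / (2 * eps) : ℝ) +
        (relEnt (volume.withDensity fun x => ENNReal.ofReal (heatT n t f x)) volume -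
          relEnt (volume.withDensity fun x => ENNReal.ofReal (f x)) volume)) := by
  have := isProbabilityMeasure_heatGauss n
  have hκ : Measurable fun z : EuclideanSpace ℝ (Fin n) × EuclideanSpace ℝ (Fin n) =>
    heatKer n eps z.1 z.2 := (continuous_heatKer n eps).measurable
  have hκ0 : ∀ z : EuclideanSpace ℝ (Fin n) × EuclideanSpace ℝ (Fin n),
    0 < heatKer n eps z.1 z.2 := fun z => heatKer_pos n heps _ _
  have isq : Integrable (fun w => ‖w.1 - w.2‖ ^ 2) pl :=
    integrable_norm_sub_sq_of_map (by rw [hfst]; exact hf1.2) (by rw [hsnd]; exact hg1.2)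
  obtain ⟨ρ, hρ, rfl, hlρ⟩ := exists_density_of_relEnt_ne_top hκ hκ0
    (integrable_log_heatKer heps isq) hpl
  set T : EuclideanSpace ℝ (Fin n) → EuclideanSpace ℝ (Fin n) × EuclideanSpace ℝ (Fin n) :=
    fun z => (√t • z, √s • z) with hT
  have hTm : Measurable T := by fun_prop
  set ν : Measure (EuclideanSpace ℝ (Fin n) × EuclideanSpace ℝ (Fin n)) :=
    volume.prod volume with hν
  set π₀ := ν.withDensity ρ with hπ₀
  have hFm : Measurable fun x => ENNReal.ofReal (f x) := by fun_prop
  have hGm : Measurable fun x => ENNReal.ofReal (g x) := by fun_prop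
  have hF' : (fun x => ENNReal.ofReal (heatT n t f x)) =
      fun x => ∫⁻ z, ENNReal.ofReal (f (x - (T z).1)) ∂heatGauss n :=
    funext fun x => ofReal_heatT n ht hf hf0 hfi x
  have hG' : (fun x => ENNReal.ofReal (heatT n s g x)) =
      fun x => ∫⁻ z, ENNReal.ofReal (g (x - (T z).2)) ∂heatGauss n :=
    funext fun x => ofReal_heatT n hs hg hg0 hgi x
  have hF'm : Measurable fun x => ENNReal.ofReal (heatT n t f x) := by
    rw [hF']
    exact Measurable.lintegral_prod_right'
      (f := fun q : EuclideanSpace ℝ (Fin n) × EuclideanSpace ℝ (Fin n) =>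
        ENNReal.ofReal (f (q.1 - (T q.2).1))) (by fun_prop)
  set ρ' : EuclideanSpace ℝ (Fin n) × EuclideanSpace ℝ (Fin n) → ℝ≥0∞ :=
    fun w => ∫⁻ z, ρ (w - T z) ∂heatGauss n with hρ'
  have hρ'm : Measurable ρ' := Measurable.lintegral_prod_right'
      (f := fun q : (EuclideanSpace ℝ (Fin n) × EuclideanSpace ℝ (Fin n)) ×
        EuclideanSpace ℝ (Fin n) => ρ (q.1 - T q.2)) (by fun_prop)
  have hadd : Measurable fun p : (EuclideanSpace ℝ (Fin n) × EuclideanSpace ℝ (Fin n)) ×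
        EuclideanSpace ℝ (Fin n) => p.1 + T p.2 := by fun_prop
  have hmap := map_add_prod_withDensity ν (heatGauss n) hρ hTm
  have hprob : IsProbabilityMeasure (ν.withDensity ρ') := by
    rw [hρ', ← hmap]; exact Measure.isProbabilityMeasure_map hadd.aemeasurable
  have hfst' : (ν.withDensity ρ').map Prod.fst =
      volume.withDensity fun x => ENNReal.ofReal (heatT n t f x) := by
    have h := Measure.map_prod_map π₀ (heatGauss n) measurable_fst measurable_id
    rw [Measure.map_id] at h
    rw [hF', ← map_add_prod_withDensity volume (heatGauss n) hFm (T := fun z => (T z).1)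
      (by fun_prop), ← hfst, h, hρ', ← hmap, Measure.map_map (by fun_prop) hadd,
      Measure.map_map (by fun_prop) (by fun_prop)]
    rfl
  have hsnd' : (ν.withDensity ρ').map Prod.snd =
      volume.withDensity fun x => ENNReal.ofReal (heatT n s g x) := by
    have h := Measure.map_prod_map π₀ (heatGauss n) measurable_snd measurable_id
    rw [Measure.map_id] at h
    rw [hG', ← map_add_prod_withDensity volume (heatGauss n) hGm (T := fun z => (T z).2)
      (by fun_prop), ← hsnd, h, hρ', ← hmap, Measure.map_map (by fun_prop) hadd,
      Measure.map_map (by fun_prop) (by fun_prop)]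
    rfl
  have isq' : Integrable (fun w => ‖w.1 - w.2‖ ^ 2) (ν.withDensity ρ') :=
    integrable_norm_sub_sq_of_map (by rw [hfst']; exact hf2.2) (by rw [hsnd']; exact hg2.2)
  have hsq : ∫ w, ‖w.1 - w.2‖ ^ 2 ∂ν.withDensity ρ' =
      ∫ w, ‖w.1 - w.2‖ ^ 2 ∂π₀ + n * (√t - √s) ^ 2 := by
    rw [← integral_norm_sub_sq_add_heatGauss n hn π₀ isq, hρ', ← hmap,
      integral_map hadd.aemeasurable (by fun_prop)]
    rfl
  have hlF := integrable_log_of_relEnt_ne_top hFm hf1.1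
  have hlF' := integrable_log_of_relEnt_ne_top hF'm hf2.1
  have hgauss : Integrable (fun w : EuclideanSpace ℝ (Fin n) × EuclideanSpace ℝ (Fin n) =>
      Real.exp (-(1 / 2) * ‖w.1‖ ^ 2 + -(1 / 2) * ‖w.2‖ ^ 2)) ν := by
    simp only [Real.exp_add]
    exact (integrable_exp_neg_half_norm_sq n).mul_prod (integrable_exp_neg_half_norm_sq n)
  have hgauss' : Integrable (fun w : EuclideanSpace ℝ (Fin n) × EuclideanSpace ℝ (Fin n) =>
      -(1 / 2) * ‖w.1‖ ^ 2 + -(1 / 2) * ‖w.2‖ ^ 2) (ν.withDensity ρ') := by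
    have i1 := hf2.2
    have i2 := hg2.2
    rw [← hfst'] at i1
    rw [← hsnd'] at i2
    exact ((i1.comp_measurable measurable_fst).const_mul _).add
      ((i2.comp_measurable measurable_snd).const_mul _)
  obtain ⟨hlρ', hle⟩ := integral_log_averaged_density_le volume ν (heatGauss n) hρ hFm hTm hfst
    hρ' hF' hlρ hlF hlF' (by fun_prop) hgauss hgauss'
  refine ⟨ν.withDensity ρ', hprob, hfst', hsnd', ?_⟩
  rw [heatR01, relEnt_withDensity_of_integrable hFm hlF,
    relEnt_withDensity_of_integrable hF'm hlF',
    relEnt_withDensity_withDensity hρ'm hκ hκ0 hlρ' (integrable_log_heatKer heps isq'),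
    relEnt_withDensity_withDensity hρ hκ hκ0 hlρ (integrable_log_heatKer heps isq),
    integral_log_heatKer heps isq, integral_log_heatKer heps isq', hsq]
  norm_cast
  rw [add_div]
  linarith

theorem integrable_of_isFiniteMeasure_withDensity {α : Type*} [MeasurableSpace α] {μ : Measure α}
    {f : α → ℝ} (hf : Measurable f) (hf0 : ∀ x, 0 ≤ f x)
    [IsFiniteMeasure (μ.withDensity fun x => ENNReal.ofReal (f x))] : Integrable f μ := by
  refine ⟨hf.aestronglyMeasurable, ?_⟩
  rw [hasFiniteIntegral_iff_ofReal (ae_of_all _ hf0), ← setLIntegral_univ,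
    ← withDensity_apply _ MeasurableSet.univ]
  exact measure_lt_top _ _

/-- **Dimensional contraction in entropic cost for the heat semigroup**
(Theorem `thm-contr` (b)): for all `s, t ≥ 0`,
`A^ε(T_t f·Leb, T_s g·Leb) ≤ A^ε(f·Leb, g·Leb) + (n/2)(√t − √s)² +
ε[H(T_t f·Leb|Leb) − H(f·Leb|Leb)]`. -/
theorem heat_entropic_cost_dimensional_contraction (n : ℕ) (hn : 0 < n)
    (eps : ℝ) (heps : 0 < eps) (s t : ℝ) (hs : 0 ≤ s) (ht : 0 ≤ t)
    (f g : EuclideanSpace ℝ (Fin n) → ℝ)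
    (hf : Measurable f) (hf0 : ∀ x, 0 ≤ f x)
    (hg : Measurable g) (hg0 : ∀ x, 0 ≤ g x)
    (hfP : IsProbabilityMeasure
      ((volume : Measure (EuclideanSpace ℝ (Fin n))).withDensity fun x => ENNReal.ofReal (f x)))
    (hgP : IsProbabilityMeasure
      ((volume : Measure (EuclideanSpace ℝ (Fin n))).withDensity fun x => ENNReal.ofReal (g x)))
    (hNice1 : NiceMarginal n
      ((volume : Measure (EuclideanSpace ℝ (Fin n))).withDensity fun x => ENNReal.ofReal (f x)))
    (hNice2 : NiceMarginal n
      ((volume : Measure (EuclideanSpace ℝ (Fin n))).withDensity fun x => ENNReal.ofReal (g x)))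
    (hNice3 : NiceMarginal n
      ((volume : Measure (EuclideanSpace ℝ (Fin n))).withDensity fun x =>
        ENNReal.ofReal (heatT n t f x)))
    (hNice4 : NiceMarginal n
      ((volume : Measure (EuclideanSpace ℝ (Fin n))).withDensity fun x =>
        ENNReal.ofReal (heatT n s g x))) :
    heatA n eps
        ((volume : Measure (EuclideanSpace ℝ (Fin n))).withDensity fun x =>
          ENNReal.ofReal (heatT n t f x))
        ((volume : Measure (EuclideanSpace ℝ (Fin n))).withDensity fun x =>
          ENNReal.ofReal (heatT n s g x)) ≤
      heatA n eps
          ((volume : Measure (EuclideanSpace ℝ (Fin n))).withDensity fun x =>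
            ENNReal.ofReal (f x))
          ((volume : Measure (EuclideanSpace ℝ (Fin n))).withDensity fun x =>
            ENNReal.ofReal (g x)) +
        (((n : ℝ) / 2 * (Real.sqrt t - Real.sqrt s) ^ 2 : ℝ) : EReal) +
        ((eps : ℝ) : EReal) *
          (relEnt ((volume : Measure (EuclideanSpace ℝ (Fin n))).withDensity fun x =>
              ENNReal.ofReal (heatT n t f x)) volume -
            relEnt ((volume : Measure (EuclideanSpace ℝ (Fin n))).withDensity fun x =>
              ENNReal.ofReal (f x)) volume) := by
  have hfi := integrable_of_isFiniteMeasure_withDensity (μ := volume) hf hf0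
  have hgi := integrable_of_isFiniteMeasure_withDensity (μ := volume) hg hg0
  set μf := (volume : Measure (EuclideanSpace ℝ (Fin n))).withDensity
    fun x => ENNReal.ofReal (f x) with hμf
  set μg := (volume : Measure (EuclideanSpace ℝ (Fin n))).withDensity
    fun x => ENNReal.ofReal (g x) with hμg
  set μf' := (volume : Measure (EuclideanSpace ℝ (Fin n))).withDensity
    fun x => ENNReal.ofReal (heatT n t f x) with hμf'
  set μg' := (volume : Measure (EuclideanSpace ℝ (Fin n))).withDensity
    fun x => ENNReal.ofReal (heatT n s g x) with hμg'
  have hreal : ∀ μ : Measure (EuclideanSpace ℝ (Fin n)), NiceMarginal n μ →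
      ∃ r : ℝ, relEnt μ volume = r := by
    intro μ hμ
    exact ⟨_, if_pos (relEnt_ne_top_iff.1 hμ.1)⟩
  obtain ⟨r, hr⟩ := hreal μf hNice1
  obtain ⟨r', hr'⟩ := hreal μf' hNice3
  have key : entCost (heatR01 n eps) μf' μg' ≤ entCost (heatR01 n eps) μf μg +
      ((n * (√t - √s) ^ 2 / (2 * eps) + (r' - r) : ℝ) : EReal) := by
    rw [← EReal.sub_le_iff_le_add (.inl (EReal.coe_ne_bot _)) (.inl (EReal.coe_ne_top _))]
    refine le_sInf ?_
    rintro _ ⟨pl, hpl, h1, h2, rfl⟩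
    rw [EReal.sub_le_iff_le_add (.inl (EReal.coe_ne_bot _)) (.inl (EReal.coe_ne_top _))]
    by_cases htop : relEnt pl (heatR01 n eps) = ⊤
    · rw [htop, EReal.top_add_coe]
      exact le_top
    obtain ⟨pl', hpl', h1', h2', hle⟩ := exists_coupling_heatT_relEnt_le n hn heps hs ht hf hf0 hfi
      hg hg0 hgi hNice1 hNice2 hNice3 hNice4 pl h1 h2 htop
    have hmem : entCost (heatR01 n eps) μf' μg' ≤ relEnt pl' (heatR01 n eps) :=
      sInf_le ⟨pl', hpl', h1', h2', rfl⟩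
    refine hmem.trans (hle.trans_eq ?_)
    rw [← hμf, ← hμf', hr, hr']
    norm_cast
  have heps' : (0 : EReal) ≤ (eps : EReal) := by exact_mod_cast heps.le
  rw [heatA, heatA, hr, hr']
  refine (mul_le_mul_of_nonneg_left key heps').trans_eq ?_
  rw [EReal.left_distrib_of_nonneg_of_ne_top heps' (EReal.coe_ne_top _), add_assoc]
  congr 1
  norm_cast
  field_simp
end
end
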